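/- For every ε > 0 there is a constant C(ε) such that for all positive integers q, l, x with gcd(l, q) = 1 and q ≤ x^{1/3}: the number of squarefull integers n ≤ x with n ≡ l (mod q) is at most C(ε)·x^{1/2+ε}/q. -/

import Mathlib

/-- A positive integer is squarefull (powerful) if every prime dividing it
divides it at least twice. -/
def Squarefull (n : ℕ) : Prop := ∀ p : ℕ, p.Prime → p ∣ n → p ^ 2 ∣ n

namespace SquarefullAP

open Finset

/-- The weight of the monomial `x ^ i * z ^ j` at the pole. -/
def wt (p : ℕ) (k : ℕ × Fin p) : ℕ := p * k.1 + (p + 3) * k.2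

/-- The monomials `x ^ i * z ^ j`, `j < p`, of weight at most `n`. -/
def monos (p n : ℕ) : Finset (ℕ × Fin p) :=
  (range (n + 1) ×ˢ univ).filter fun k => wt p k ≤ n

lemma mem_monos {p n : ℕ} (hp : 0 < p) (k : ℕ × Fin p) : k ∈ monos p n ↔ wt p k ≤ n := by
  simp only [monos, mem_filter, mem_product, mem_range, mem_univ, and_true, and_iff_right_iff_imp]
  intro h
  have : k.1 ≤ p * k.1 := Nat.le_mul_of_pos_left _ hp
  unfold wt at h
  omega

lemma wt_injective {p : ℕ} (hp : p.Prime) (hp3 : 3 < p) : Function.Injective (wt p) := by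
  rintro ⟨i, j⟩ ⟨i', j'⟩ h
  simp only [wt] at h
  have hj : (j : ℕ) = j' := by
    have h1 : 3 * (j : ℕ) ≡ 3 * (j' : ℕ) [MOD p] := by
      have h2 : (p * i + (p + 3) * (j : ℕ)) % p = (p * i' + (p + 3) * (j' : ℕ)) % p := by rw [h]
      have e1 : p * i + (p + 3) * (j : ℕ) = 3 * j + p * (i + j) := by ring
      have e2 : p * i' + (p + 3) * (j' : ℕ) = 3 * j' + p * (i' + j') := by ring
      rw [e1, e2, Nat.add_mul_mod_self_left, Nat.add_mul_mod_self_left] at h2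
      exact h2
    have h3 : Nat.gcd p 3 = 1 := by
      refine (Nat.coprime_primes hp Nat.prime_three).2 (by omega)
    have h4 := Nat.ModEq.cancel_left_of_coprime h3 h1
    exact Nat.ModEq.eq_of_lt_of_lt h4 j.2 j'.2
  have hi : i = i' := by
    rw [hj] at h
    have := Nat.add_right_cancel h
    exact Nat.eq_of_mul_eq_mul_left hp.pos this
  exact Prod.ext hi (Fin.ext hj)

lemma card_monos_le {p : ℕ} (hp : p.Prime) (hp3 : 3 < p) (n : ℕ) : #(monos p n) ≤ n + 1 := by
  have := card_le_card_of_injOn (s := monos p n) (t := range (n + 1)) (wt p)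
    (fun k hk => by
      have := (mem_monos hp.pos k).1 hk
      simp only [coe_range, Set.mem_Iio]; omega)
    (wt_injective hp hp3).injOn
  simpa using this

lemma le_card_monos {p : ℕ} (hp : p.Prime) (hp3 : 3 < p) (n : ℕ) :
    n + 1 ≤ #(monos p n) + p * (p + 3) := by
  have hsub : Ico (p * (p + 3)) (n + 1) ⊆ (monos p n).image (wt p) := by
    intro w hw
    rw [mem_Ico] at hw
    have : Fact p.Prime := ⟨hp⟩
    set j : ℕ := ((w : ZMod p) * (3 : ZMod p)⁻¹).val with hj
    have hjp : j < p := ZMod.val_lt _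
    have h3 : (3 : ZMod p) ≠ 0 := by
      intro h
      have : ((3 : ℕ) : ZMod p) = 0 := by exact_mod_cast h
      rw [ZMod.natCast_eq_zero_iff] at this
      have := Nat.le_of_dvd (by norm_num) this
      omega
    have hle : (p + 3) * j ≤ w := by nlinarith
    have hdvd : p ∣ w - (p + 3) * j := by
      rw [← ZMod.natCast_eq_zero_iff, Nat.cast_sub hle]
      push_cast
      rw [hj, ZMod.natCast_val, ZMod.cast_id', id]
      simp only [CharP.cast_eq_zero, zero_add]
      field_simp
      ring
    obtain ⟨i, hi⟩ := hdvd
    rw [mem_image]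
    have e : wt p (i, ⟨j, hjp⟩) = w := by
      simp only [wt]; omega
    exact ⟨(i, ⟨j, hjp⟩), (mem_monos hp.pos _).2 (by rw [e]; omega), e⟩
  have h1 := card_le_card hsub
  have h2 := card_image_le (s := monos p n) (f := wt p)
  simp only [Nat.card_Ico] at h1
  omega

section Curve

variable {K R : Type} [Field K] [CommRing R] [Algebra K R] {p : ℕ} (x z : R)

/-- The span of the monomials of weight at most `n`. -/
def filt (K : Type) {R : Type} [Field K] [CommRing R] [Algebra K R] (p : ℕ) (x z : R) (n : ℕ) :
    Submodule K R :=
  Submodule.span K {r | ∃ i j : ℕ, p * i + (p + 3) * j ≤ n ∧ r = x ^ i * z ^ j}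

lemma mono_mem_filt {i j n : ℕ} (h : p * i + (p + 3) * j ≤ n) :
    x ^ i * z ^ j ∈ filt K p x z n :=
  Submodule.subset_span ⟨i, j, h, rfl⟩

lemma filt_mono {a b : ℕ} (h : a ≤ b) : filt K p x z a ≤ filt K p x z b :=
  Submodule.span_mono fun _ ⟨i, j, hij, hr⟩ => ⟨i, j, hij.trans h, hr⟩

lemma filt_mul {a b : ℕ} {r s : R} (hr : r ∈ filt K p x z a) (hs : s ∈ filt K p x z b) :
    r * s ∈ filt K p x z (a + b) := by
  have h := Submodule.mul_mem_mul hr hs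
  rw [filt, filt, Submodule.span_mul_span] at h
  refine Submodule.span_mono ?_ h
  rintro _ ⟨_, ⟨i, j, hij, rfl⟩, _, ⟨i', j', hij', rfl⟩, rfl⟩
  exact ⟨i + i', j + j', by nlinarith, by simp only; ring⟩

lemma filt_pow {a : ℕ} {r : R} (hr : r ∈ filt K p x z a) (n : ℕ) :
    r ^ n ∈ filt K p x z (n * a) := by
  induction n with
  | zero => simpa using mono_mem_filt (K := K) (p := p) x z (i := 0) (j := 0) (n := 0 * a) (by simp)
  | succ n ih =>
    rw [pow_succ, add_mul, one_mul]
    exact filt_mul x z ih hr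

lemma filt_eq_span_monos (hp : 2 ≤ p) {α β γ : K}
    (hrel : z ^ p = x ^ (p - 1) * z + α • x ^ (p + 3) + β • x ^ (p - 2) + γ • x ^ p) (n : ℕ) :
    filt K p x z n =
      Submodule.span K ((fun k : ℕ × Fin p => x ^ k.1 * z ^ (k.2 : ℕ)) '' (monos p n : Set _)) := by
  apply le_antisymm
  · rw [filt, Submodule.span_le]
    rintro _ ⟨i, j, hij, rfl⟩
    induction j using Nat.strong_induction_on generalizing i with
    | _ j ih =>
      by_cases hj : j < p
      · exact Submodule.subset_span ⟨(i, ⟨j, hj⟩), (mem_monos (by omega) _).2 hij, rfl⟩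
      · obtain ⟨d, rfl⟩ : ∃ d, j = d + p := ⟨j - p, by omega⟩
        obtain ⟨e, rfl⟩ : ∃ e, p = e + 2 := ⟨p - 2, by omega⟩
        have h1 : x ^ i * z ^ (d + (e + 2)) = x ^ (i + e + 1) * z ^ (d + 1)
            + α • (x ^ (i + e + 5) * z ^ d) + β • (x ^ (i + e) * z ^ d)
            + γ • (x ^ (i + e + 2) * z ^ d) := by
          rw [pow_add z d, hrel]
          simp only [Algebra.smul_def, Nat.add_sub_cancel,
            show e + 2 - 1 = e + 1 from rfl]
          ring
        simp only [SetLike.mem_coe]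
        rw [h1]
        refine Submodule.add_mem _ (Submodule.add_mem _ (Submodule.add_mem _ ?_ ?_) ?_) ?_
        · exact ih _ (by omega) _ (by nlinarith)
        · exact Submodule.smul_mem _ _ (ih _ (by omega) _ (by nlinarith))
        · exact Submodule.smul_mem _ _ (ih _ (by omega) _ (by nlinarith))
        · exact Submodule.smul_mem _ _ (ih _ (by omega) _ (by nlinarith))
  · rw [Submodule.span_le]
    rintro _ ⟨k, hk, rfl⟩
    exact mono_mem_filt x z ((mem_monos (by omega) k).1 hk)

end Curve

section Curve

variable {K R : Type} [Field K] [CommRing R] [Algebra K R] {p : ℕ} (x z : R)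

/-- The basis monomial `x ^ i * z ^ j`. -/
def mono (k : ℕ × Fin p) : R := x ^ k.1 * z ^ (k.2 : ℕ)

lemma mono_mem (k : ℕ × Fin p) : mono x z k ∈ filt K p x z (wt p k) :=
  mono_mem_filt x z le_rfl

lemma sum_mem_filt (hp : 0 < p) (m : ℕ) (a : ℕ × Fin p → K) :
    ∑ k ∈ monos p m, a k • mono x z k ∈ filt K p x z m :=
  Submodule.sum_mem _ fun k hk => Submodule.smul_mem _ _
    (filt_mono x z ((mem_monos hp k).1 hk) (mono_mem x z k))

/-- A combination of basis monomials multiplied by `x ^ c` has weight at least `p * c`. -/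
lemma coeff_eq_zero_of_mem_filt (hp : 2 ≤ p) {α β γ : K}
    (hrel : z ^ p = x ^ (p - 1) * z + α • x ^ (p + 3) + β • x ^ (p - 2) + γ • x ^ p)
    (hli : LinearIndependent K (mono (p := p) x z)) {m c e : ℕ} (he : e < p * c)
    (a : ℕ × Fin p → K)
    (h : (∑ k ∈ monos p m, a k • mono x z k) * x ^ c ∈ filt K p x z e) :
    ∀ k ∈ monos p m, a k = 0 := by
  rw [filt_eq_span_monos x z hp hrel] at h
  let sh : ℕ × Fin p → ℕ × Fin p := fun k => (k.1 + c, k.2)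
  have hsh : Function.Injective sh := by
    rintro ⟨i, j⟩ ⟨i', j'⟩ h
    simp only [sh, Prod.mk.injEq] at h
    exact Prod.ext (by omega) h.2
  have hS : (∑ k ∈ monos p m, a k • mono x z k) * x ^ c
      = ∑ k ∈ monos p m, a k • mono x z (sh k) := by
    rw [sum_mul]
    refine sum_congr rfl fun k _ => ?_
    simp only [mono, sh, Algebra.smul_def]
    ring
  have hmem : (∑ k ∈ monos p m, a k • mono x z (sh k)) ∈
      Submodule.span K (mono x z '' (Set.range sh)) :=
    Submodule.sum_mem _ fun k _ => Submodule.smul_mem _ _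
      (Submodule.subset_span ⟨sh k, ⟨k, rfl⟩, rfl⟩)
  have hdis : Disjoint (Set.range sh) (monos p e : Set (ℕ × Fin p)) := by
    rw [Set.disjoint_left]
    rintro _ ⟨k, rfl⟩ hk
    have := (mem_monos (by omega) _).1 (mem_coe.1 hk)
    simp only [wt, sh] at this
    nlinarith
  rw [hS] at h
  have h0 := Submodule.disjoint_def.1 (hli.disjoint_span_image hdis) _ hmem h
  have hli' := hli.comp sh hsh
  rw [linearIndependent_iff'] at hli'
  exact hli' _ _ h0

lemma z_pow_mul (hp : p.Prime) [CharP R p] {α β γ : K}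
    (hrel : z ^ p = x ^ (p - 1) * z + α • x ^ (p + 3) + β • x ^ (p - 2) + γ • x ^ p) (s : ℕ) :
    ∃ r ∈ filt K p x z (p ^ s * (p ^ 2 + 3)),
      z ^ (p * p ^ s) = r + α ^ (p ^ s) • x ^ ((p + 3) * p ^ s) := by
  have : Fact p.Prime := ⟨hp⟩
  obtain ⟨e, he⟩ : ∃ e, p = e + 2 := ⟨p - 2, by have := hp.two_le; omega⟩
  refine ⟨(x ^ (p - 1) * z + β • x ^ (p - 2) + γ • x ^ p) ^ (p ^ s), ?_, ?_⟩
  · refine filt_pow x z (Submodule.add_mem _ (Submodule.add_mem _ ?_ ?_) ?_) _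
    · simpa using mono_mem_filt (K := K) (p := p) x z (i := p - 1) (j := 1) (n := p ^ 2 + 3)
        (by subst he; simp only [show e + 2 - 1 = e + 1 from rfl]; nlinarith)
    · refine Submodule.smul_mem _ _ ?_
      simpa using mono_mem_filt (K := K) (p := p) x z (i := p - 2) (j := 0) (n := p ^ 2 + 3)
        (by subst he; simp only [Nat.add_sub_cancel]; nlinarith)
    · refine Submodule.smul_mem _ _ ?_
      simpa using mono_mem_filt (K := K) (p := p) x z (i := p) (j := 0) (n := p ^ 2 + 3)
        (by nlinarith)
  · rw [pow_mul z, hrel]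
    have : x ^ (p - 1) * z + α • x ^ (p + 3) + β • x ^ (p - 2) + γ • x ^ p
      = (x ^ (p - 1) * z + β • x ^ (p - 2) + γ • x ^ p) + α • x ^ (p + 3) := by ring
    rw [this, add_pow_char_pow, smul_pow, ← pow_mul]

/-- The auxiliary function of the Stepanov method does not vanish identically. -/
lemma auxiliary_ne_zero (hp : p.Prime) (hp3 : 3 < p) [CharP R p] {α β γ : K} (hα : α ≠ 0)
    (hrel : z ^ p = x ^ (p - 1) * z + α • x ^ (p + 3) + β • x ^ (p - 2) + γ • x ^ p)
    (hli : LinearIndependent K (mono (p := p) x z)) {s m n : ℕ} (hm : m < p ^ s)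
    (a : ℕ × Fin p → ℕ × Fin p → K)
    (h : ∑ k ∈ monos p n, (∑ k' ∈ monos p m, a k k' • mono x z k') * mono x z k ^ (p ^ s) = 0) :
    ∀ k ∈ monos p n, ∀ k' ∈ monos p m, a k k' = 0 := by
  classical
  by_contra! hcon
  set Q := p ^ s with hQ
  set D : ℕ × Fin p → R := fun k => ∑ k' ∈ monos p m, a k k' • mono x z k' with hD
  have hDmem : ∀ k, D k ∈ filt K p x z m := fun k => sum_mem_filt x z hp.pos m (a k)
  obtain ⟨k₀, hk₀, hmax⟩ := exists_max_image
    ((monos p n).filter fun k => ∃ k' ∈ monos p m, a k k' ≠ 0) (wt p)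
    (by obtain ⟨k, hk, hk'⟩ := hcon; exact ⟨k, mem_filter.2 ⟨hk, hk'⟩⟩)
  rw [mem_filter] at hk₀
  obtain ⟨hk₀n, k₁, hk₁, hne⟩ := hk₀
  apply hne
  obtain ⟨i, j⟩ := k₀
  obtain ⟨r, hr, hz⟩ := z_pow_mul x z hp hrel s
  rw [← hQ] at hr hz
  obtain ⟨d, hd⟩ : ∃ d, p = j + d := ⟨p - j, by have := j.2; omega⟩
  have hd0 : 0 < d := by have := j.2; omega
  set e := m + Q * (p * (i + p + 3) - 1) with he
  have hQ0 : 0 < Q := pow_pos hp.pos s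
  have hpi : 1 ≤ p * (i + p + 3) := Nat.mul_pos hp.pos (by omega)
  refine coeff_eq_zero_of_mem_filt x z hp.two_le hrel hli (m := m) (c := (i + p + 3) * Q) (e := e)
    ?_ (a (i, j)) ?_ k₁ hk₁
  · have : Q * (p * (i + p + 3) - 1) + Q = p * ((i + p + 3) * Q) := by
      obtain ⟨w, hw⟩ : ∃ w, p * (i + p + 3) = w + 1 := ⟨_, (Nat.sub_add_cancel hpi).symm⟩
      rw [hw, Nat.add_sub_cancel]
      have : p * ((i + p + 3) * Q) = (p * (i + p + 3)) * Q := by ring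
      rw [this, hw]; ring
    omega
  · have hsplit : ∑ k ∈ (monos p n).erase (i, j), D k * mono x z k ^ Q
        + D (i, j) * mono x z (i, j) ^ Q = 0 := by
      rw [sum_erase_add _ _ hk₀n]; exact h
    have hmain : D (i, j) * mono x z (i, j) ^ Q * z ^ (d * Q)
        = D (i, j) * (x ^ (i * Q) * r) + α ^ Q • (D (i, j) * x ^ ((i + p + 3) * Q)) := by
      have : mono x z (i, j) ^ Q * z ^ (d * Q) = x ^ (i * Q) * z ^ (p * Q) := by
        have hpQ : p * Q = j * Q + d * Q := by
          rw [← add_mul]; exact congrArg (· * Q) hd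
        simp only [mono]
        rw [hpQ]
        ring
      rw [mul_assoc, this, hz]
      simp only [Algebra.smul_def]
      ring
    have hrest : ∀ k ∈ (monos p n).erase (i, j), D k * mono x z k ^ Q * z ^ (d * Q)
        ∈ filt K p x z e := by
      intro k hk
      rw [mem_erase] at hk
      by_cases hk0 : ∃ k' ∈ monos p m, a k k' ≠ 0
      · have hlt : wt p k < wt p (i, j) := lt_of_le_of_ne (hmax k (mem_filter.2 ⟨hk.2, hk0⟩))
          fun hh => hk.1 (wt_injective hp hp3 hh)
        have hzd : z ^ (d * Q) ∈ filt K p x z (Q * ((p + 3) * d)) := by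
          simpa using mono_mem_filt (K := K) (p := p) x z (i := 0) (j := d * Q)
            (n := Q * ((p + 3) * d)) (by nlinarith)
        refine filt_mono x z ?_ (filt_mul x z (filt_mul x z (hDmem k)
          (filt_pow x z (mono_mem x z k) Q)) hzd)
        have hwt : wt p k + 1 + (p + 3) * d ≤ p * (i + p + 3) := by
          have : wt p (i, j) + (p + 3) * d = p * (i + p + 3) := by
            have : p * (i + p + 3) = p * i + (p + 3) * p := by ring
            have hpd : (p + 3) * p = (p + 3) * (j + d) := congrArg ((p + 3) * ·) hd
            rw [this, hpd]
            simp only [wt]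
            ring
          omega
        have : Q * wt p k + Q * ((p + 3) * d) = Q * (wt p k + (p + 3) * d) := by ring
        rw [he, add_assoc, this]
        exact Nat.add_le_add_left (Nat.mul_le_mul_left _ (by omega)) _
      · push Not at hk0
        have : D k = 0 := sum_eq_zero fun k' hk' => by rw [hk0 k' hk', zero_smul]
        rw [this, zero_mul, zero_mul]
        exact Submodule.zero_mem _
    have hr' : D (i, j) * (x ^ (i * Q) * r) ∈ filt K p x z e := by
      have hx : x ^ (i * Q) ∈ filt K p x z (Q * (p * i)) := by
        simpa using mono_mem_filt (K := K) (p := p) x z (i := i * Q) (j := 0)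
          (n := Q * (p * i)) (by nlinarith)
      refine filt_mono x z ?_ (filt_mul x z (hDmem _) (filt_mul x z hx hr))
      rw [he, ← mul_add]
      refine Nat.add_le_add_left (Nat.mul_le_mul_left _ ?_) _
      have : p * (i + p + 3) = p * i + p ^ 2 + 3 * p := by ring
      omega
    have hfin : α ^ Q • (D (i, j) * x ^ ((i + p + 3) * Q)) ∈ filt K p x z e := by
      have h1 : (∑ k ∈ (monos p n).erase (i, j), D k * mono x z k ^ Q * z ^ (d * Q))
          + (D (i, j) * (x ^ (i * Q) * r) + α ^ Q • (D (i, j) * x ^ ((i + p + 3) * Q))) = 0 := by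
        rw [← hmain, ← sum_mul, ← add_mul, hsplit, zero_mul]
      have h2 := Submodule.add_mem _ (Submodule.sum_mem _ hrest) hr'
      have h3 : α ^ Q • (D (i, j) * x ^ ((i + p + 3) * Q)) =
        -((∑ k ∈ (monos p n).erase (i, j), D k * mono x z k ^ Q * z ^ (d * Q))
          + D (i, j) * (x ^ (i * Q) * r)) := by linear_combination h1
      rw [h3]
      exact Submodule.neg_mem _ h2
    exact (Submodule.smul_mem_iff _ (pow_ne_zero _ hα)).1 hfin

end Curve

section Curve

variable {K R : Type} [Field K] [CommRing R] [Algebra K R] {p : ℕ} (x z : R)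

/-- A nontrivial auxiliary function whose pullback vanishes along the graph of Frobenius. -/
lemma exists_auxiliary (hp : p.Prime) [Fintype K] [CharP K p] {α β γ : K}
    (hrel : z ^ p = x ^ (p - 1) * z + α • x ^ (p + 3) + β • x ^ (p - 2) + γ • x ^ p)
    {s m n : ℕ} (hcard : #(monos p (p ^ s * m + n)) < #(monos p n) * #(monos p m)) :
    ∃ a : ℕ × Fin p → ℕ × Fin p → K,
      (∃ k ∈ monos p n, ∃ k' ∈ monos p m, a k k' ≠ 0) ∧
      ∑ k ∈ monos p n, ∑ k' ∈ monos p m,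
        (a k k') ^ (p ^ s) • (mono x z k' ^ (p ^ s) * mono x z k) = 0 := by
  classical
  have : Fact p.Prime := ⟨hp⟩
  let v : (monos p n ×ˢ monos p m : Finset _) → R := fun k =>
    mono x z k.1.2 ^ (p ^ s) * mono x z k.1.1
  have hv : ¬ LinearIndependent K v := by
    intro hv
    have h := linearIndependent_le_span_aux' v hv
      (((monos p (p ^ s * m + n)).image (mono x z) : Finset R) : Set R) (by
        rintro _ ⟨⟨k, hk⟩, rfl⟩
        rw [mem_product] at hk
        have h1 := filt_mul x z (filt_pow x z (mono_mem (K := K) x z k.2) (p ^ s))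
          (mono_mem (K := K) x z k.1)
        have h2 := filt_mono (K := K) x z (b := p ^ s * m + n) (by
          have h3 := (mem_monos hp.pos k.2).1 hk.2
          have h4 := (mem_monos hp.pos k.1).1 hk.1
          gcongr) h1
        rw [filt_eq_span_monos x z hp.two_le hrel] at h2
        rw [coe_image]
        exact h2)
    have h5 := card_image_le (s := monos p (p ^ s * m + n)) (f := mono x z)
    simp only [Fintype.card_coe, card_product, coe_sort_coe] at h
    omega
  rw [Fintype.not_linearIndependent_iff] at hv
  obtain ⟨g, hg, ⟨⟨k₀, hk₀⟩, hne⟩⟩ := hv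
  rw [mem_product] at hk₀
  let b : (ℕ × Fin p) × (ℕ × Fin p) → K := fun k =>
    if h : k ∈ monos p n ×ˢ monos p m then g ⟨k, h⟩ else 0
  have hb : ∀ k, (iterateFrobeniusEquiv K p s).symm (b k) ^ (p ^ s) = b k := fun k => by
    rw [← iterateFrobeniusEquiv_def, RingEquiv.apply_symm_apply]
  refine ⟨fun k k' => (iterateFrobeniusEquiv K p s).symm (b (k, k')), ⟨k₀.1, hk₀.1, k₀.2, hk₀.2, ?_⟩,
    ?_⟩
  · intro h
    rw [map_eq_zero_iff _ (RingEquiv.injective _)] at h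
    apply hne
    simp only [b] at h
    rw [dif_pos (mem_product.2 hk₀)] at h
    exact h
  · simp only [hb]
    rw [← sum_product', ← sum_coe_sort]
    rw [← hg]
    refine sum_congr rfl fun k _ => ?_
    simp only [b, v]
    rw [dif_pos k.2]

/-- Few `t` are such that a given nonzero combination of the monomials of weight at most `N`
vanishes at all points above `t`. -/
lemma card_mul_le_of_vanish (hp : p.Prime) [CharP K p] {f : K → K} {N : ℕ} (h : ℕ × Fin p → K)
    {k₀ : ℕ × Fin p} (hk₀ : k₀ ∈ monos p N) (hk₀ne : h k₀ ≠ 0)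
    (hvan : ∀ t y : K, t ≠ 0 → y ^ p - y = f t →
      ∑ k ∈ monos p N, h k * t ^ k.1 * (t * y) ^ (k.2 : ℕ) = 0)
    (Z : Finset K) (hZ : ∀ t ∈ Z, t ≠ 0 ∧ ∃ y : K, y ^ p - y = f t) :
    p * #Z ≤ N := by
  classical
  have : Fact p.Prime := ⟨hp⟩
  let g : Polynomial K := ∑ k ∈ (monos p N).filter (fun k => k.2 = k₀.2),
    Polynomial.monomial k.1 (h k)
  have hg0 : g ≠ 0 := by
    intro hg
    apply hk₀ne
    have := congrArg (fun f => Polynomial.coeff f k₀.1) hg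
    simp only [g, Polynomial.finsetSum_coeff, Polynomial.coeff_monomial,
      Polynomial.coeff_zero] at this
    rw [sum_eq_single k₀] at this
    · simpa using this
    · intro k hk hkne
      rw [mem_filter] at hk
      rw [if_neg]
      intro h1
      exact hkne (Prod.ext h1 hk.2)
    · intro hk
      exact (hk (mem_filter.2 ⟨hk₀, rfl⟩)).elim
  have hgdeg : p * g.natDegree ≤ N := by
    have : g.natDegree ≤ N / p := by
      refine Polynomial.natDegree_sum_le_of_forall_le _ _ fun k hk => ?_
      refine (Polynomial.natDegree_monomial_le _).trans ?_
      rw [mem_filter, mem_monos hp.pos] at hk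
      rw [Nat.le_div_iff_mul_le hp.pos, mul_comm]
      have := hk.1
      unfold wt at this
      exact le_trans (Nat.le_add_right _ _) this
    exact (Nat.mul_le_mul_left p this).trans (Nat.mul_div_le _ _)
  have hroot : ∀ t ∈ Z, g.eval t = 0 := by
    intro t ht
    obtain ⟨ht0, y, hy⟩ := hZ t ht
    let P : Polynomial K := ∑ k ∈ monos p N, Polynomial.monomial (k.2 : ℕ) (h k * t ^ k.1)
    have hP : P = 0 := by
      refine Polynomial.eq_zero_of_natDegree_lt_card_of_eval_eq_zero' P
        ((range p).image fun c : ℕ => t * (y + c)) ?_ ?_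
      · intro w hw
        rw [mem_image] at hw
        obtain ⟨c, _, rfl⟩ := hw
        have := hvan t (y + c) ht0 (by
          have hc : (c : K) ^ p = c := by
            have := map_natCast (frobenius K p) c
            rwa [frobenius_def] at this
          rw [add_pow_char, hc, ← hy]; ring)
        simpa [P, Polynomial.eval_finsetSum] using this
      · rw [card_image_of_injOn, card_range]
        · refine lt_of_le_of_lt (Polynomial.natDegree_sum_le_of_forall_le _ _
            (n := p - 1) fun k _ => ?_) (Nat.sub_lt hp.pos one_pos)
          refine (Polynomial.natDegree_monomial_le _).trans ?_
          have := k.2.2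
          omega
        · intro c hc d hd hcd
          simp only at hcd
          have := mul_left_cancel₀ ht0 hcd
          have := add_left_cancel this
          exact CharP.natCast_injOn_Iio K p (by simpa using hc) (by simpa using hd) this
    have := congrArg (fun f => Polynomial.coeff f (k₀.2 : ℕ)) hP
    simp only [P, Polynomial.finsetSum_coeff, Polynomial.coeff_monomial,
      Polynomial.coeff_zero, Fin.val_inj] at this
    rw [← this, ← sum_filter]
    simp only [g, Polynomial.eval_finsetSum, Polynomial.eval_monomial]
  refine le_trans (Nat.mul_le_mul_left _ ?_) hgdeg
  refine Polynomial.card_le_degree_of_subset_roots fun t ht => ?_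
  rw [Polynomial.mem_roots hg0]
  exact hroot t ht

/-- Stepanov's bound, in Bombieri's form, for the number of `t` lying below rational points. -/
lemma stepanov_abstract (hp : p.Prime) (hp3 : 3 < p) [Fintype K] [CharP K p] {s : ℕ}
    (hK : Fintype.card K = (p ^ s) ^ 2) {α β γ : K} (hα : α ≠ 0)
    (hrel : z ^ p = x ^ (p - 1) * z + α • x ^ (p + 3) + β • x ^ (p - 2) + γ • x ^ p)
    (hli : LinearIndependent K (mono (p := p) x z))
    (heval : ∀ t y : K, t ≠ 0 → y ^ p - y = α * t ^ 3 + β * t⁻¹ ^ 2 + γ →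
      ∃ φ : R →ₐ[K] K, φ x = t ∧ φ z = t * y)
    (Z : Finset K) (hZ : ∀ t ∈ Z, t ≠ 0 ∧ ∃ y : K, y ^ p - y = α * t ^ 3 + β * t⁻¹ ^ 2 + γ)
    (hQ : (p * (p + 3)) ^ 2 + 3 * (p * (p + 3)) + 1 < p ^ s) :
    p * #Z ≤ (p ^ s) ^ 2 + (2 * (p * (p + 3)) + 1) * p ^ s := by
  classical
  have : Fact p.Prime := ⟨hp⟩
  have hR : Nontrivial R := by
    have h1 := hli.ne_zero (0, ⟨0, hp.pos⟩)
    exact nontrivial_of_ne _ _ h1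
  have : CharP R p := charP_of_injective_algebraMap (algebraMap K R).injective p
  set κ := p * (p + 3) with hκ
  set Q := p ^ s with hQdef
  obtain ⟨m, hm⟩ : ∃ m, Q = m + 1 := ⟨Q - 1, by omega⟩
  set n := Q + 2 * κ with hn
  have hcard : #(monos p (p ^ s * m + n)) < #(monos p n) * #(monos p m) := by
    have h1 := card_monos_le hp hp3 (p ^ s * m + n)
    have h2 := le_card_monos hp hp3 n
    have h3 := le_card_monos hp hp3 m
    rw [← hκ] at h2 h3
    rw [← hQdef] at h1
    have h4 := Nat.mul_le_mul (show Q + κ + 1 ≤ #(monos p n) by omega)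
      (show Q - κ ≤ #(monos p m) by omega)
    refine lt_of_le_of_lt h1 (lt_of_lt_of_le ?_ h4)
    obtain ⟨d, hd⟩ : ∃ d, Q = d + κ := ⟨Q - κ, by
      have : κ ≤ Q := by nlinarith
      omega⟩
    have hd' : Q - κ = d := by omega
    rw [hd']
    have hmd : m + 1 = d + κ := by omega
    have h5 : Q * m + Q = Q * (d + κ) := by rw [← hmd]; ring
    have h6 : Q * (d + κ) + 2 * κ + 1 < (Q + κ + 1) * d := by
      rw [hd] at hQ ⊢
      nlinarith
    rw [hn]
    omega
  obtain ⟨a, hane, ha⟩ := exists_auxiliary x z hp hrel hcard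
  rw [← hQdef] at ha
  set H : R := ∑ k ∈ monos p n, (∑ k' ∈ monos p m, a k k' • mono x z k') * mono x z k ^ Q with hH
  have hH0 : H ≠ 0 := by
    intro h
    obtain ⟨k, hk, k', hk', hne⟩ := hane
    exact hne (auxiliary_ne_zero x z hp hp3 hα hrel hli (by omega) a h k hk k' hk')
  set N := m + Q * n with hN
  have hHmem : H ∈ filt K p x z N :=
    Submodule.sum_mem _ fun k hk => filt_mul x z (sum_mem_filt x z hp.pos m (a k))
      (filt_mono x z (Nat.mul_le_mul_left Q ((mem_monos hp.pos k).1 hk))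
        (filt_pow x z (mono_mem x z k) Q))
  rw [filt_eq_span_monos x z hp.two_le hrel] at hHmem
  change H ∈ Submodule.span K (mono x z '' _) at hHmem
  rw [Submodule.mem_span_image_finset_iff_exists_fun] at hHmem
  obtain ⟨h₀, hh₀⟩ := hHmem
  let h : ℕ × Fin p → K := fun k => if hk : k ∈ monos p N then h₀ ⟨k, hk⟩ else 0
  have hh : ∑ k ∈ monos p N, h k • mono x z k = H := by
    rw [← sum_coe_sort, ← hh₀]
    refine sum_congr rfl fun k _ => ?_
    simp only [h]
    rw [dif_pos k.2]
  obtain ⟨k₀, hk₀, hk₀ne⟩ : ∃ k ∈ monos p N, h k ≠ 0 := by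
    by_contra! hcon
    exact hH0 (hh ▸ sum_eq_zero fun k hk => by rw [hcon k hk, zero_smul])
  have hvan : ∀ t y : K, t ≠ 0 → y ^ p - y = α * t ^ 3 + β * t⁻¹ ^ 2 + γ →
      ∑ k ∈ monos p N, h k * t ^ k.1 * (t * y) ^ (k.2 : ℕ) = 0 := by
    intro t y ht hy
    obtain ⟨φ, hx, hz⟩ := heval t y ht hy
    have hφ : ∀ k : ℕ × Fin p, φ (mono x z k) = t ^ k.1 * (t * y) ^ (k.2 : ℕ) := fun k => by
      simp [mono, hx, hz]
    have h1 : φ H = ∑ k ∈ monos p N, h k * t ^ k.1 * (t * y) ^ (k.2 : ℕ) := by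
      rw [← hh, map_sum]
      refine sum_congr rfl fun k _ => ?_
      rw [map_smul, hφ, smul_eq_mul, mul_assoc]
    rw [← h1]
    have h2 : φ H ^ Q = 0 := by
      have h3 := congrArg φ ha
      rw [map_zero] at h3
      rw [← h3, hH, map_sum, hQdef, sum_pow_char_pow, map_sum, ← hQdef]
      refine sum_congr rfl fun k _ => ?_
      rw [map_mul, map_sum, mul_pow, map_sum, hQdef, sum_pow_char_pow, sum_mul, ← hQdef]
      refine sum_congr rfl fun k' _ => ?_
      rw [map_smul, map_smul, smul_pow, map_mul, map_pow, map_pow, smul_mul_assoc, ← pow_mul,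
        ← pow_two, ← hK, FiniteField.pow_card]
    exact pow_eq_zero_iff (by omega) |>.1 h2
  have : N ≤ Q ^ 2 + (2 * κ + 1) * Q := by
    rw [hN, hn]
    nlinarith
  exact (card_mul_le_of_vanish hp h hk₀ hk₀ne hvan Z hZ).trans this

end Curve

section Curve

open Polynomial

variable {K : Type} [Field K] {p : ℕ}

/-- The polynomial defining the Artin-Schreier curve, in the coordinate `z = x * y`. -/
noncomputable def curvePoly (p : ℕ) (α β γ : K) : K[X][X] :=
  X ^ p - (C (X ^ (p - 1)) * X +
    C (C α * X ^ (p + 3) + C β * X ^ (p - 2) + C γ * X ^ p))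

lemma curvePoly_natDegree_aux (hp : 2 ≤ p) (α β γ : K) :
    (C (X ^ (p - 1)) * X +
      C (C α * X ^ (p + 3) + C β * X ^ (p - 2) + C γ * X ^ p) : K[X][X]).degree < (p : ℕ) :=
  lt_of_le_of_lt degree_linear_le (by exact_mod_cast hp)

lemma curvePoly_monic (hp : 2 ≤ p) (α β γ : K) : (curvePoly p α β γ).Monic :=
  monic_X_pow_sub (curvePoly_natDegree_aux hp α β γ)

lemma curvePoly_natDegree (hp : 2 ≤ p) (α β γ : K) : (curvePoly p α β γ).natDegree = p := by
  unfold curvePoly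
  rw [natDegree_sub_eq_left_of_natDegree_lt, natDegree_X_pow]
  rw [natDegree_X_pow]
  exact lt_of_le_of_lt natDegree_linear_le (by omega)

lemma eval₂_curvePoly {A : Type} [CommRing A] (i : K[X] →+* A) (a : A) (α β γ : K) :
    eval₂ i a (curvePoly p α β γ) = a ^ p - (i X ^ (p - 1) * a +
      (i (C α) * i X ^ (p + 3) + i (C β) * i X ^ (p - 2) + i (C γ) * i X ^ p)) := by
  simp only [curvePoly, eval₂_sub, eval₂_add, eval₂_mul, eval₂_C, eval₂_X, eval₂_pow, map_add,
    map_mul, map_pow]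

/-- Stepanov's bound for the Artin-Schreier curve `y ^ p - y = α t ^ 3 + β t ^ (-2) + γ`. -/
lemma stepanov_bound (hp : p.Prime) (hp3 : 3 < p) [Fintype K] [CharP K p] {s : ℕ}
    (hK : Fintype.card K = (p ^ s) ^ 2) {α : K} (β γ : K) (hα : α ≠ 0)
    (Z : Finset K) (hZ : ∀ t ∈ Z, t ≠ 0 ∧ ∃ y : K, y ^ p - y = α * t ^ 3 + β * t⁻¹ ^ 2 + γ) :
    p * #Z ≤ (p ^ s) ^ 2 + p * ((p * (p + 3)) ^ 2 + 3 * (p * (p + 3)) + 1) * p ^ s := by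
  rcases le_or_gt (p ^ s) ((p * (p + 3)) ^ 2 + 3 * (p * (p + 3)) + 1) with hQ | hQ
  · have h1 : #Z ≤ (p ^ s) ^ 2 := hK ▸ card_le_univ Z
    calc p * #Z ≤ p * (p ^ s) ^ 2 := Nat.mul_le_mul_left _ h1
      _ = p * p ^ s * p ^ s := by ring
      _ ≤ p * ((p * (p + 3)) ^ 2 + 3 * (p * (p + 3)) + 1) * p ^ s := by gcongr
      _ ≤ _ := Nat.le_add_left _ _
  · set F := curvePoly p α β γ with hF
    have hp2 := hp.two_le
    have hmonic : F.Monic := curvePoly_monic hp2 α β γ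
    set x : AdjoinRoot F := AdjoinRoot.of F X with hx
    set z : AdjoinRoot F := AdjoinRoot.root F with hz
    have hof : ∀ c : K, AdjoinRoot.of F (C c) = algebraMap K (AdjoinRoot F) c := fun c => rfl
    have hrel : z ^ p = x ^ (p - 1) * z + α • x ^ (p + 3) + β • x ^ (p - 2) + γ • x ^ p := by
      have h := AdjoinRoot.eval₂_root F
      rw [show eval₂ (AdjoinRoot.of F) (AdjoinRoot.root F) F = _ from
        eval₂_curvePoly (AdjoinRoot.of F) (AdjoinRoot.root F) α β γ, hof, hof, hof] at h
      rw [sub_eq_zero] at h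
      rw [h]
      simp only [Algebra.smul_def]
      ring
    have hli : LinearIndependent K (mono (p := p) x z) := by
      have h1 := ((basisMonomials K).smulTower (AdjoinRoot.powerBasis' hmonic).basis).linearIndependent
      have hdim : p = (AdjoinRoot.powerBasis' hmonic).dim := by
        rw [AdjoinRoot.powerBasis'_dim, curvePoly_natDegree hp2]
      have h2 := h1.comp (fun k : ℕ × Fin p => (k.1, finCongr hdim k.2))
        (fun a b hab => by
          simp only [Prod.mk.injEq, EmbeddingLike.apply_eq_iff_eq] at hab
          exact Prod.ext hab.1 hab.2)
      convert h2 using 1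
      funext k
      simp only [mono, Function.comp, Module.Basis.smulTower_apply, PowerBasis.coe_basis,
        AdjoinRoot.powerBasis'_gen, coe_basisMonomials, Algebra.smul_def]
      rw [monomial_one_right_eq_X_pow, map_pow]
      rfl
    refine (stepanov_abstract x z hp hp3 hK hα hrel hli ?_ Z hZ hQ).trans ?_
    · intro t y ht hy
      refine ⟨AdjoinRoot.liftAlgHom F (aeval t) (t * y) ?_, ?_, ?_⟩
      · rw [hF, eval₂_curvePoly]
        have hpp : t ^ p = t ^ (p - 1) * t := by rw [← pow_succ, Nat.sub_add_cancel hp.one_le]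
        have hpp2 : t ^ p = t ^ (p - 2) * t ^ 2 := by
          rw [← pow_add, Nat.sub_add_cancel hp.two_le]
        have hb : t ^ (p - 2) = t ^ p * t⁻¹ ^ 2 := by
          rw [hpp2]; field_simp
        have : y ^ p = y + (α * t ^ 3 + β * t⁻¹ ^ 2 + γ) := by rw [← hy]; ring
        simp only [RingHom.coe_coe, aeval_X, aeval_C, Algebra.algebraMap_self_apply, mul_pow]
        rw [this, pow_add, hb]
        linear_combination y * hpp
      · rw [hx]
        simp
      · rw [hz]
        simp
    · have : 2 * (p * (p + 3)) + 1 ≤ p * ((p * (p + 3)) ^ 2 + 3 * (p * (p + 3)) + 1) := by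
        nlinarith [Nat.le_mul_of_pos_left ((p * (p + 3)) ^ 2 + 3 * (p * (p + 3)) + 1) hp.pos]
      gcongr

end Curve

section AdditiveHilbert

variable {p : ℕ} [Fact p.Prime] {K : Type} [Field K] [Finite K] [Algebra (ZMod p) K]

/-- The additive form of Hilbert's Theorem 90 for finite fields. -/
lemma exists_pow_sub_eq_iff_trace (w : K) :
    (∃ y : K, y ^ p - y = w) ↔ Algebra.trace (ZMod p) K w = 0 := by
  have : CharP K p := charP_of_injective_algebraMap (algebraMap (ZMod p) K).injective p
  let L : K →ₗ[ZMod p] K := (FiniteField.frobeniusAlgHom (ZMod p) K).toLinearMap - LinearMap.id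
  have hL : ∀ y, L y = y ^ p - y := fun y => by
    simp [L, ZMod.card]
  have hle : LinearMap.range L ≤ LinearMap.ker (Algebra.trace (ZMod p) K) := by
    rintro _ ⟨y, rfl⟩
    rw [LinearMap.mem_ker, hL, map_sub, sub_eq_zero]
    have := Algebra.trace_eq_of_algEquiv (FiniteField.frobeniusAlgEquivOfAlgebraic (ZMod p) K) y
    rwa [FiniteField.coe_frobeniusAlgEquivOfAlgebraic, ZMod.card] at this
  have hker : Module.finrank (ZMod p) (LinearMap.ker L) ≤ 1 := by
    refine finrank_le_one (⟨1, by simp [hL]⟩ : LinearMap.ker L) ?_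
    rintro ⟨y, hy⟩
    rw [LinearMap.mem_ker, hL, sub_eq_zero] at hy
    rw [← Subfield.mem_bot_iff_pow_eq_self, mem_bot_iff_intCast p] at hy
    obtain ⟨n, rfl⟩ := hy
    exact ⟨n, Subtype.ext (by simp [Algebra.smul_def])⟩
  have h1 := LinearMap.finrank_range_add_finrank_ker L
  have h2 := LinearMap.finrank_range_add_finrank_ker (Algebra.trace (ZMod p) K)
  have h3 : Module.finrank (ZMod p) (LinearMap.range (Algebra.trace (ZMod p) K)) = 1 := by
    rw [LinearMap.range_eq_top.2 (Algebra.trace_surjective _ _), finrank_top, Module.finrank_self]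
  have heq := Submodule.eq_of_le_of_finrank_le hle (by omega)
  rw [← LinearMap.mem_ker, ← heq, LinearMap.mem_range]
  simp only [hL]

end AdditiveHilbert

section ExpSum

variable {p : ℕ} [Fact p.Prime]

/-- The exponential sum attached to `α t ^ 3 + β t ^ (-2)` over an extension of `ZMod p`. -/
noncomputable def expSum (ψ : AddChar (ZMod p) ℂ) (K : Type) [Field K] [Fintype K]
    [DecidableEq K] [Algebra (ZMod p) K] (α β : ZMod p) : ℂ :=
  ∑ t : Kˣ, ψ (Algebra.trace (ZMod p) K
    (algebraMap _ K α * (t : K) ^ 3 + algebraMap _ K β * (t : K)⁻¹ ^ 2))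

/-- The constant in the Stepanov bound. -/
def stepanovConst (p : ℕ) : ℕ := p * ((p * (p + 3)) ^ 2 + 3 * (p * (p + 3)) + 1)

lemma norm_expSum_le (hp3 : 3 < p) {ψ : AddChar (ZMod p) ℂ} (hψ : ψ ≠ 1) (K : Type) [Field K]
    [Fintype K] [DecidableEq K] [Algebra (ZMod p) K] {s : ℕ} (hK : Fintype.card K = (p ^ s) ^ 2)
    {α : ZMod p} (hα : α ≠ 0) (β : ZMod p) :
    ‖expSum ψ K α β‖ ≤ (stepanovConst p + 1) * (p : ℝ) ^ s := by
  classical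
  have hp : p.Prime := Fact.out
  have : CharP K p := charP_of_injective_algebraMap (algebraMap (ZMod p) K).injective p
  set f : Kˣ → ZMod p := fun t => Algebra.trace (ZMod p) K
    (algebraMap _ K α * (t : K) ^ 3 + algebraMap _ K β * (t : K)⁻¹ ^ 2) with hf
  set N : ZMod p → ℕ := fun c => #{t : Kˣ | f t = c} with hN
  have hNle : ∀ c, p * N c ≤ (p ^ s) ^ 2 + stepanovConst p * p ^ s := by
    intro c
    obtain ⟨γ, hγ⟩ := Algebra.trace_surjective (ZMod p) K (-c)
    have := stepanov_bound hp hp3 hK (α := algebraMap _ K α) (algebraMap _ K β) γ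
      (by rwa [Ne, map_eq_zero]) (({t : Kˣ | f t = c} : Finset Kˣ).image fun t : Kˣ => (t : K)) (by
        intro t ht
        rw [mem_image] at ht
        obtain ⟨u, hu, rfl⟩ := ht
        rw [mem_filter] at hu
        refine ⟨u.ne_zero, ?_⟩
        rw [exists_pow_sub_eq_iff_trace, map_add, hγ]
        have h2 : f u = c := hu.2
        rw [← h2, hf]
        simp)
    rw [card_image_of_injective _ Units.val_injective] at this
    exact this
  have hsumN : ∑ c, N c = (p ^ s) ^ 2 - 1 := by
    rw [← hK, ← Fintype.card_units, ← card_univ, ← card_eq_sum_card_fiberwise (f := f)]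
    simp
  have hexp : expSum ψ K α β = ∑ c, (N c : ℂ) * ψ c := by
    rw [expSum]
    rw [← sum_fiberwise_of_maps_to (g := f) (t := univ) (by simp)]
    refine sum_congr rfl fun c _ => ?_
    rw [sum_congr rfl (g := fun _ => ψ c), sum_const, nsmul_eq_mul]
    intro t ht
    rw [mem_filter] at ht
    rw [← ht.2]
  set B : ℝ := ((p ^ s) ^ 2 + stepanovConst p * p ^ s : ℕ) / p with hB
  have hppos : (0 : ℝ) < p := by exact_mod_cast hp.pos
  have hD : ∀ c, (0 : ℝ) ≤ B - N c := fun c => by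
    rw [sub_nonneg, hB, le_div_iff₀ hppos, mul_comm]
    exact_mod_cast hNle c
  have hexp2 : expSum ψ K α β = -∑ c, ((B - N c : ℝ) : ℂ) * ψ c := by
    have h0 : ∑ c, ψ c = 0 := AddChar.sum_eq_zero_of_ne_one hψ
    push_cast
    simp only [sub_mul, sum_sub_distrib, ← mul_sum, h0, mul_zero, zero_sub, neg_neg]
    exact hexp
  have hsN : (∑ c, (N c : ℝ)) = ((p : ℝ) ^ s) ^ 2 - 1 := by
    have h1 : 1 ≤ (p ^ s) ^ 2 := Nat.one_le_pow _ _ (pow_pos hp.pos s)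
    have := congrArg (Nat.cast (R := ℝ)) hsumN
    rw [Nat.cast_sub h1] at this
    push_cast at this
    exact this
  rw [hexp2, norm_neg]
  calc ‖∑ c, ((B - N c : ℝ) : ℂ) * ψ c‖ ≤ ∑ c, (B - N c) := by
        refine (norm_sum_le _ _).trans (sum_le_sum fun c _ => ?_)
        rw [norm_mul, AddChar.norm_apply, mul_one, Complex.norm_real, Real.norm_of_nonneg (hD c)]
    _ = stepanovConst p * (p : ℝ) ^ s + 1 := by
        rw [sum_sub_distrib, hsN, sum_const, card_univ, ZMod.card, nsmul_eq_mul, hB]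
        rw [mul_div_cancel₀ _ hppos.ne']
        push_cast
        ring
    _ ≤ _ := by
        have : (1 : ℝ) ≤ (p : ℝ) ^ s := one_le_pow₀ (by exact_mod_cast hp.one_le)
        linarith

end ExpSum

section PowerSum

open Polynomial

variable {F : Type} [Field F] (α β : F)

/-- For a monic polynomial with nonzero roots `r`, this is the sum of `α r ^ 3 + β r ^ (-2)`,
expressed through the coefficients. -/
noncomputable def rootSum (g : F[X]) : F :=
  α * (-g.reverse.coeff 1 ^ 3 + 3 * g.reverse.coeff 1 * g.reverse.coeff 2 - 3 * g.reverse.coeff 3) +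
    β * ((g.coeff 1 / g.coeff 0) ^ 2 - 2 * (g.coeff 2 / g.coeff 0))

lemma rootSum_one : rootSum α β (1 : F[X]) = 0 := by
  have h : (1 : F[X]).reverse = 1 := by
    simpa using reverse_C (1 : F)
  simp [rootSum, h, coeff_one]

lemma coeff_zero_reverse_of_monic {g : F[X]} (hg : g.Monic) : g.reverse.coeff 0 = 1 := by
  rw [coeff_zero_reverse]; exact hg

lemma rootSum_mul {g h : F[X]} (hg : g.Monic) (hh : h.Monic) (hg0 : g.coeff 0 ≠ 0)
    (hh0 : h.coeff 0 ≠ 0) : rootSum α β (g * h) = rootSum α β g + rootSum α β h := by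
  have hg1 := coeff_zero_reverse_of_monic hg
  have hh1 := coeff_zero_reverse_of_monic hh
  simp only [rootSum, reverse_mul_of_domain, coeff_mul, Nat.antidiagonal_succ, Nat.antidiagonal_zero,
    Finset.sum_cons, Finset.map_cons, Finset.map_singleton, Finset.sum_singleton,
    Function.Embedding.prodMap, Function.Embedding.coeFn_mk, Prod.map, Function.Embedding.refl_apply,
    Nat.succ_eq_add_one, hg1, hh1, zero_add, Nat.reduceAdd]
  field_simp
  ring

lemma rootSum_X_sub_C {r : F} (hr : r ≠ 0) : rootSum α β (X - C r) = α * r ^ 3 + β * r⁻¹ ^ 2 := by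
  have h1 : (X - C r).reverse.coeff 1 = -r := by
    rw [coeff_reverse, natDegree_X_sub_C]
    simp [revAt_le]
  have h2 : (X - C r).reverse.coeff 2 = 0 := by
    rw [coeff_reverse, natDegree_X_sub_C, revAt_eq_self_of_lt (by norm_num)]
    simp [coeff_X]
  have h3 : (X - C r).reverse.coeff 3 = 0 := by
    rw [coeff_reverse, natDegree_X_sub_C, revAt_eq_self_of_lt (by norm_num)]
    simp [coeff_X]
  simp only [rootSum, h1, h2, h3, coeff_sub, coeff_X, coeff_C]
  norm_num
  field_simp

lemma rootSum_map {E : Type} [Field E] (i : F →+* E) (g : F[X]) :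
    rootSum (i α) (i β) (g.map i) = i (rootSum α β g) := by
  simp only [rootSum, coeff_reverse, natDegree_map, coeff_map, map_add, map_mul, map_sub, map_neg,
    map_pow, map_div₀, map_ofNat]

lemma monic_multiset_prod (s : Multiset F) : (s.map fun r => X - C r).prod.Monic :=
  monic_multiset_prod_of_monic _ _ fun r _ => monic_X_sub_C r

lemma coeff_zero_multiset_prod_ne_zero {s : Multiset F} (hs : (0 : F) ∉ s) :
    (s.map fun r => X - C r).prod.coeff 0 ≠ 0 := by
  rw [coeff_zero_eq_eval_zero, eval_multiset_prod]
  refine Multiset.prod_ne_zero ?_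
  simp only [Multiset.map_map, Multiset.mem_map, Function.comp, eval_sub, eval_X, eval_C]
  rintro ⟨r, hr, h⟩
  rw [zero_sub, neg_eq_zero] at h
  exact hs (h ▸ hr)

lemma rootSum_multiset_prod (s : Multiset F) (hs : (0 : F) ∉ s) :
    rootSum α β (s.map fun r => X - C r).prod = (s.map fun r => α * r ^ 3 + β * r⁻¹ ^ 2).sum := by
  induction s using Multiset.induction with
  | empty => simp [rootSum_one]
  | cons a s ih =>
    rw [Multiset.mem_cons, not_or] at hs
    rw [Multiset.map_cons, Multiset.prod_cons, Multiset.map_cons, Multiset.sum_cons,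
      rootSum_mul α β (monic_X_sub_C a) (monic_multiset_prod s) ?_
        (coeff_zero_multiset_prod_ne_zero hs.2), ih hs.2, rootSum_X_sub_C α β (Ne.symm hs.1)]
    simpa using Ne.symm hs.1

lemma algebraMap_rootSum {E : Type} [Field E] [IsAlgClosed E] [Algebra F E] {g : F[X]}
    (hg : g.Monic) (hg0 : g.coeff 0 ≠ 0) :
    algebraMap F E (rootSum α β g) =
      ((g.aroots E).map fun r => algebraMap F E α * r ^ 3 + algebraMap F E β * r⁻¹ ^ 2).sum := by
  have hmap := hg.map (algebraMap F E)
  have h1 := (IsAlgClosed.splits (g.map (algebraMap F E))).eq_prod_roots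
  rw [hmap.leadingCoeff, map_one, one_mul] at h1
  have h0 : (0 : E) ∉ g.aroots E := by
    intro h
    rw [aroots, mem_roots hmap.ne_zero, IsRoot, ← coeff_zero_eq_eval_zero, coeff_map,
      map_eq_zero] at h
    exact hg0 h
  rw [← rootSum_map, h1]
  exact rootSum_multiset_prod _ _ _ h0

end PowerSum

section Trace

open Polynomial IntermediateField

variable {F : Type} [Field F] {L : Type} [Field L] [Algebra F L]
  [Algebra.IsSeparable F L] (α β : F)

lemma minpoly_coeff_zero_ne {t : L} (ht : t ≠ 0) : (minpoly F t).coeff 0 ≠ 0 :=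
  (minpoly.coeff_zero_eq_zero (Algebra.IsIntegral.isIntegral t)).not.2 ht

variable [FiniteDimensional F L]

lemma trace_eq_nsmul_rootSum {t : L} (ht : t ≠ 0) :
    Algebra.trace F L (algebraMap F L α * t ^ 3 + algebraMap F L β * t⁻¹ ^ 2) =
      Module.finrank F⟮t⟯ L • rootSum α β (minpoly F t) := by
  classical
  have h_int : IsIntegral F t := Algebra.IsIntegral.isIntegral t
  have : Algebra.IsSeparable F F⟮t⟯ := Algebra.isSeparable_tower_bot_of_isSeparable F F⟮t⟯ L
  set u : F⟮t⟯ := AdjoinSimple.gen F t with hu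
  set w : F⟮t⟯ := algebraMap F F⟮t⟯ α * u ^ 3 + algebraMap F F⟮t⟯ β * u⁻¹ ^ 2 with hw
  have h1 : algebraMap F L α * t ^ 3 + algebraMap F L β * t⁻¹ ^ 2 = algebraMap F⟮t⟯ L w := by
    simp [hw, hu]
  rw [h1, ← Algebra.trace_trace (S := F⟮t⟯), Algebra.trace_algebraMap, map_nsmul]
  congr 1
  apply (algebraMap F (AlgebraicClosure F)).injective
  rw [trace_eq_sum_embeddings (AlgebraicClosure F), algebraMap_rootSum α β (minpoly.monic h_int)
    (minpoly_coeff_zero_ne ht)]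
  have hnd : ((minpoly F t).aroots (AlgebraicClosure F)).Nodup :=
    nodup_aroots_iff_of_splits (minpoly.ne_zero h_int) (IsAlgClosed.splits _) |>.2
      (Algebra.IsSeparable.isSeparable F t)
  have h2 : ((minpoly F t).aroots (AlgebraicClosure F)) =
      ((minpoly F t).aroots (AlgebraicClosure F)).toFinset.val := by
    rw [Multiset.toFinset_val, Multiset.dedup_eq_self.2 hnd]
  rw [h2]
  refine Eq.trans ?_ (Finset.sum_coe_sort ((minpoly F t).aroots (AlgebraicClosure F)).toFinset
    fun r => algebraMap F (AlgebraicClosure F) α * r ^ 3 +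
      algebraMap F (AlgebraicClosure F) β * r⁻¹ ^ 2)
  refine Fintype.sum_equiv ((algHomAdjoinIntegralEquiv F h_int).trans
    (Equiv.subtypeEquivRight (q := fun x => x ∈ ((minpoly F t).aroots
      (AlgebraicClosure F)).toFinset) fun x => Multiset.mem_toFinset.symm)) _ _ fun σ => ?_
  have h3 := algHomAdjoinIntegralEquiv_symm_apply_gen F h_int (algHomAdjoinIntegralEquiv F h_int σ)
  rw [Equiv.symm_apply_apply] at h3
  simp only [Equiv.trans_apply, Equiv.subtypeEquivRight_apply_coe]
  rw [← h3, hw, hu]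
  simp

end Trace

section Monics

open Polynomial IntermediateField UniqueFactorizationMonoid
open scoped Classical

variable {F : Type} [Field F]

lemma finite_monics [Finite F] (n : ℕ) :
    {g : F[X] | g.Monic ∧ g.natDegree = n ∧ g.coeff 0 ≠ 0}.Finite := by
  refine Set.Finite.subset (Set.Finite.of_finite_image (f := fun (g : F[X]) (i : Fin (n + 1)) =>
    g.coeff i) (s := {g : F[X] | g.natDegree = n}) (Set.toFinite _) ?_) (fun g hg => hg.2.1)
  intro g hg h hh hgh
  ext i
  by_cases hi : i < n + 1
  · exact congrFun hgh ⟨i, hi⟩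
  · rw [coeff_eq_zero_of_natDegree_lt, coeff_eq_zero_of_natDegree_lt]
    · rw [Set.mem_ofPred_eq] at hh; omega
    · rw [Set.mem_ofPred_eq] at hg; omega

/-- The monic polynomials of degree `n` with nonzero constant term. -/
noncomputable def monics (F : Type) [Field F] [Finite F] (n : ℕ) : Finset F[X] :=
  (finite_monics (F := F) n).toFinset

lemma mem_monics [Finite F] {n : ℕ} {g : F[X]} :
    g ∈ monics F n ↔ g.Monic ∧ g.natDegree = n ∧ g.coeff 0 ≠ 0 := by
  simp [monics]

variable {L : Type} [Field L] [Algebra F L]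

/-- The characteristic polynomial of an element of a finite extension. -/
noncomputable def charPoly (F : Type) [Field F] {L : Type} [Field L] [Algebra F L] (t : L) : F[X] :=
  minpoly F t ^ Module.finrank F⟮t⟯ L

lemma natDegree_minpoly_mul_finrank [FiniteDimensional F L] (t : L) :
    (minpoly F t).natDegree * Module.finrank F⟮t⟯ L = Module.finrank F L := by
  rw [← Module.finrank_mul_finrank F F⟮t⟯ L,
    IntermediateField.adjoin.finrank (Algebra.IsIntegral.isIntegral t)]

lemma charPoly_monic [FiniteDimensional F L] (t : L) : (charPoly F t).Monic :=
  (minpoly.monic (Algebra.IsIntegral.isIntegral t)).pow _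

lemma charPoly_mem [Finite F] [FiniteDimensional F L] [Algebra.IsSeparable F L] {t : L}
    (ht : t ≠ 0) : charPoly F t ∈ monics F (Module.finrank F L) := by
  refine mem_monics.2 ⟨charPoly_monic t, ?_, ?_⟩
  · rw [charPoly, natDegree_pow, mul_comm, natDegree_minpoly_mul_finrank]
  · rw [charPoly, coeff_zero_eq_eval_zero, eval_pow, ← coeff_zero_eq_eval_zero]
    exact pow_ne_zero _ (minpoly_coeff_zero_ne ht)

lemma card_minpoly_eq [Finite F] [Fintype L] {P : F[X]} (hP : Irreducible P)
    (hPm : P.Monic) :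
    #{t : L | minpoly F t = P} = if P.natDegree ∣ Module.finrank F L then P.natDegree else 0 := by
  have hiff : ∀ t : L, minpoly F t = P ↔ aeval t P = 0 := fun t =>
    ⟨fun h => h ▸ minpoly.aeval F t, fun h => (minpoly.eq_of_irreducible_of_monic hP h hPm).symm⟩
  split_ifs with hd
  · have : Fact (Irreducible P) := ⟨hP⟩
    have hfr : Module.finrank F (AdjoinRoot P) = P.natDegree := by
      rw [(AdjoinRoot.powerBasis hP.ne_zero).finrank, AdjoinRoot.powerBasis_dim]
    have : Module.Finite F (AdjoinRoot P) := (AdjoinRoot.powerBasis hP.ne_zero).finite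
    have : Finite (AdjoinRoot P) := Module.finite_of_finite F
    have h1 := FiniteField.natCard_algHom_of_finrank_dvd (F := F) (K := AdjoinRoot P) (L := L)
      (by rwa [hfr])
    rw [hfr] at h1
    rw [← h1, Nat.card_congr (AdjoinRoot.equiv L F P hP.ne_zero), Nat.card_eq_fintype_card,
      Fintype.card_of_subtype]
    intro t
    rw [mem_filter, hiff, mem_aroots]
    simp [hP.ne_zero]
  · rw [card_eq_zero, filter_eq_empty_iff]
    intro t _ ht
    apply hd
    rw [← ht]
    exact Dvd.intro _ (natDegree_minpoly_mul_finrank t)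

lemma card_charPoly_dvd [Finite F] [Fintype L] {g : F[X]} (hg : g.Monic) :
    #{t : L | charPoly F t ∣ g} = ∑ P ∈ (normalizedFactors g).toFinset,
      if P.natDegree ∣ Module.finrank F L ∧ P ^ (Module.finrank F L / P.natDegree) ∣ g
        then P.natDegree else 0 := by
  have hfin : FiniteDimensional F L := inferInstance
  have hfr : 0 < Module.finrank F L := Module.finrank_pos
  rw [card_eq_sum_card_fiberwise (f := fun t : L => minpoly F t)
    (t := (normalizedFactors g).toFinset)]
  · refine sum_congr rfl fun P hP => ?_
    rw [Multiset.mem_toFinset] at hP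
    have hirr := irreducible_of_normalized_factor P hP
    have hmon : P.Monic := by
      rw [← normalize_normalized_factor P hP]
      exact monic_normalize hirr.ne_zero
    have hdeg : 0 < P.natDegree := hirr.natDegree_pos
    have hchar : ∀ t : L, minpoly F t = P → charPoly F t =
        P ^ (Module.finrank F L / P.natDegree) := by
      rintro t rfl
      rw [charPoly, ← natDegree_minpoly_mul_finrank (F := F) t, Nat.mul_div_cancel_left _ hdeg]
    by_cases hd : P ^ (Module.finrank F L / P.natDegree) ∣ g
    · simp only [hd, and_true]
      rw [← card_minpoly_eq hirr hmon]
      congr 1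
      ext t
      simp only [mem_filter, mem_univ, true_and, and_iff_right_iff_imp]
      intro ht
      rwa [hchar t ht]
    · simp only [hd, and_false, if_false, card_eq_zero, filter_eq_empty_iff, mem_filter]
      rintro t ⟨_, ht⟩ h
      rw [hchar t h] at ht
      exact hd ht
  · intro t ht
    simp only [coe_filter, mem_univ, true_and, Set.mem_ofPred_eq] at ht
    rw [mem_coe, Multiset.mem_toFinset]
    have h1 : minpoly F t ∣ g := by
      refine dvd_trans (dvd_pow_self _ ?_) ht
      intro h
      have := natDegree_minpoly_mul_finrank (F := F) t
      rw [h, mul_zero] at this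
      omega
    have h_int : IsIntegral F t := Algebra.IsIntegral.isIntegral t
    obtain ⟨P, hP, hP2⟩ := exists_mem_normalizedFactors_of_dvd hg.ne_zero
      (minpoly.irreducible h_int) h1
    have := eq_of_monic_of_associated (minpoly.monic h_int) ?_ hP2
    · change minpoly F t ∈ _
      rwa [this]
    · rw [← normalize_normalized_factor P hP]
      exact monic_normalize (irreducible_of_normalized_factor P hP).ne_zero

lemma sum_natDegree_normalizedFactors {g : F[X]} (hg : g.Monic) :
    ∑ P ∈ (normalizedFactors g).toFinset, (normalizedFactors g).count P * P.natDegree =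
      g.natDegree := by
  have h1 := prod_normalizedFactors_eq hg.ne_zero
  rw [hg.normalize_eq_self] at h1
  conv_rhs => rw [← h1]
  rw [natDegree_multiset_prod _ (zero_notMem_normalizedFactors g),
    sum_multiset_map_count]
  simp

/-- Every monic polynomial of degree `n` has exactly `n` divisors that are characteristic
polynomials of elements of finite extensions, counted with multiplicity. -/
lemma sum_card_charPoly_dvd [Finite F] (L : ℕ → Type) [∀ k, Field (L k)]
    [∀ k, Algebra F (L k)] [∀ k, Fintype (L k)] (hL : ∀ k, 0 < k → Module.finrank F (L k) = k)
    {g : F[X]} (hg : g.Monic) :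
    ∑ k ∈ Icc 1 g.natDegree, #{t : L k | charPoly F t ∣ g} = g.natDegree := by
  conv_rhs => rw [← sum_natDegree_normalizedFactors hg]
  simp only [card_charPoly_dvd hg]
  rw [sum_comm]
  refine sum_congr rfl fun P hP => ?_
  rw [Multiset.mem_toFinset] at hP
  have hirr := irreducible_of_normalized_factor P hP
  have hmon : P.Monic := by
    rw [← normalize_normalized_factor P hP]
    exact monic_normalize hirr.ne_zero
  have hdeg : 0 < P.natDegree := hirr.natDegree_pos
  have hdvd : ∀ j, P ^ j ∣ g ↔ j ≤ (normalizedFactors g).count P := fun j => by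
    rw [pow_dvd_iff_le_emultiplicity, emultiplicity_eq_count_normalizedFactors hirr hg.ne_zero,
      hmon.normalize_eq_self, Nat.cast_le]
  rw [← sum_filter, sum_const, smul_eq_mul]
  congr 1
  rw [show (normalizedFactors g).count P = #(Icc 1 ((normalizedFactors g).count P)) by simp]
  symm
  refine card_bij (fun j _ => P.natDegree * j) ?_ ?_ ?_
  · intro j hj
    rw [mem_Icc] at hj
    have h1 := (hdvd j).2 hj.2
    have h2 := natDegree_le_of_dvd h1 hg.ne_zero
    rw [natDegree_pow] at h2
    have h3 : 0 < P.natDegree * j := Nat.mul_pos hdeg hj.1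
    rw [mem_filter, mem_Icc, hL _ h3, Nat.mul_div_cancel_left _ hdeg]
    exact ⟨⟨h3, by rw [mul_comm]; exact h2⟩, Dvd.intro _ rfl, h1⟩
  · intro i _ j _ h
    exact Nat.eq_of_mul_eq_mul_left hdeg h
  · intro k hk
    rw [mem_filter, mem_Icc] at hk
    obtain ⟨⟨hk1, hk2⟩, hd, hpow⟩ := hk
    rw [hL k hk1] at hd hpow
    obtain ⟨j, rfl⟩ := hd
    rw [Nat.mul_div_cancel_left _ hdeg] at hpow
    refine ⟨j, mem_Icc.2 ⟨?_, (hdvd j).1 hpow⟩, rfl⟩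
    exact Nat.pos_of_mul_pos_left hk1

end Monics

section LFunction

open Polynomial IntermediateField
open scoped Classical

variable {p : ℕ} [Fact p.Prime] (ψ : AddChar (ZMod p) ℂ) (α β : ZMod p)

/-- The coefficients of the L-function of the exponential sum. -/
noncomputable def lCoeff (n : ℕ) : ℂ := ∑ g ∈ monics (ZMod p) n, ψ (rootSum α β g)

lemma rootSum_pow {g : (ZMod p)[X]} (hg : g.Monic) (hg0 : g.coeff 0 ≠ 0) (n : ℕ) :
    rootSum α β (g ^ n) = n • rootSum α β g := by
  induction n with
  | zero => simp [rootSum_one]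
  | succ n ih =>
    rw [pow_succ, rootSum_mul α β (hg.pow n) hg ?_ hg0, ih, succ_nsmul]
    rw [coeff_zero_eq_eval_zero, eval_pow, ← coeff_zero_eq_eval_zero]
    exact pow_ne_zero _ hg0

lemma monics_zero : monics (ZMod p) 0 = {1} := by
  ext g
  rw [mem_monics, mem_singleton]
  constructor
  · rintro ⟨h1, h2, _⟩
    exact h1.natDegree_eq_zero.1 h2
  · rintro rfl
    simp

lemma lCoeff_zero : lCoeff ψ α β 0 = 1 := by
  simp [lCoeff, monics_zero, rootSum_one]

lemma rootSum_charPoly {L : Type} [Field L] [Fintype L] [Algebra (ZMod p) L] {t : L} (ht : t ≠ 0) :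
    rootSum α β (charPoly (ZMod p) t) = Algebra.trace (ZMod p) L
      (algebraMap _ L α * t ^ 3 + algebraMap _ L β * t⁻¹ ^ 2) := by
  rw [trace_eq_nsmul_rootSum α β ht, charPoly, rootSum_pow _ _ (minpoly.monic
    (Algebra.IsIntegral.isIntegral t)) (minpoly_coeff_zero_ne ht)]

lemma expSum_mul_lCoeff {L : Type} [Field L] [Fintype L] [Algebra (ZMod p) L] {n : ℕ}
    (hn : Module.finrank (ZMod p) L ≤ n) :
    expSum ψ L α β * lCoeff ψ α β (n - Module.finrank (ZMod p) L) =
      ∑ g ∈ monics (ZMod p) n, #{t : L | charPoly (ZMod p) t ∣ g} * ψ (rootSum α β g) := by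
  set k := Module.finrank (ZMod p) L with hk
  have h0 : ∀ g ∈ monics (ZMod p) n, ∀ t : L, charPoly (ZMod p) t ∣ g → t ≠ 0 := by
    rintro g hg t hd rfl
    apply (mem_monics.1 hg).2.2
    rw [← X_dvd_iff]
    refine dvd_trans ?_ hd
    rw [charPoly, minpoly.zero]
    refine dvd_pow_self _ fun h => ?_
    have := natDegree_minpoly_mul_finrank (F := ZMod p) (0 : L)
    rw [h, mul_zero] at this
    exact (Module.finrank_pos (R := ZMod p) (M := L)).ne this
  have h1 : ∑ g ∈ monics (ZMod p) n, (#{t : L | charPoly (ZMod p) t ∣ g} : ℂ) * ψ (rootSum α β g)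
      = ∑ g ∈ monics (ZMod p) n, ∑ t : Lˣ,
        if charPoly (ZMod p) (t : L) ∣ g then ψ (rootSum α β g) else 0 := by
    refine sum_congr rfl fun g hg => ?_
    rw [← sum_filter, sum_const, nsmul_eq_mul]
    congr 2
    symm
    refine card_bij (fun t _ => (t : L)) ?_ ?_ ?_
    · intro t ht
      simpa using ht
    · intro t _ u _ h
      exact Units.ext h
    · intro t ht
      rw [mem_filter] at ht
      exact ⟨Units.mk0 t (h0 g hg t ht.2), by simpa using ht.2, rfl⟩
  rw [h1, sum_comm, expSum, lCoeff, sum_mul_sum]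
  refine sum_congr rfl fun t _ => ?_
  have ht := charPoly_mem (F := ZMod p) t.ne_zero
  rw [mem_monics] at ht
  rw [← sum_filter]
  refine sum_bij (fun h _ => charPoly (ZMod p) (t : L) * h) ?_ ?_ ?_ ?_
  · intro h hh
    rw [mem_monics] at hh
    rw [mem_filter, mem_monics]
    refine ⟨⟨ht.1.mul hh.1, ?_, ?_⟩, Dvd.intro _ rfl⟩
    · rw [ht.1.natDegree_mul hh.1, ht.2.1, hh.2.1, ← hk]
      omega
    · rw [mul_coeff_zero]
      exact mul_ne_zero ht.2.2 hh.2.2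
  · intro a _ b _ hab
    exact mul_left_cancel₀ ht.1.ne_zero hab
  · intro g hg
    rw [mem_filter, mem_monics] at hg
    obtain ⟨⟨hg1, hg2, hg3⟩, h, rfl⟩ := hg
    have hh := ht.1.of_mul_monic_left hg1
    refine ⟨h, mem_monics.2 ⟨hh, ?_, ?_⟩, rfl⟩
    · rw [ht.1.natDegree_mul hh, ht.2.1] at hg2
      omega
    · rw [mul_coeff_zero] at hg3
      exact right_ne_zero_of_mul hg3
  · intro h hh
    rw [mem_monics] at hh
    rw [rootSum_mul α β ht.1 hh.1 ht.2.2 hh.2.2, AddChar.map_add_eq_mul,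
      rootSum_charPoly α β t.ne_zero]

/-- Logarithmic differentiation of the Euler product. -/
lemma nat_mul_lCoeff (L : ℕ → Type) [∀ k, Field (L k)] [∀ k, Algebra (ZMod p) (L k)]
    [∀ k, Fintype (L k)] (hL : ∀ k, 0 < k → Module.finrank (ZMod p) (L k) = k) (n : ℕ) :
    n * lCoeff ψ α β n = ∑ k ∈ Icc 1 n, expSum ψ (L k) α β * lCoeff ψ α β (n - k) := by
  have h1 : ∀ k ∈ Icc 1 n, expSum ψ (L k) α β * lCoeff ψ α β (n - k) =
      ∑ g ∈ monics (ZMod p) n, #{t : L k | charPoly (ZMod p) t ∣ g} * ψ (rootSum α β g) := by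
    intro k hk
    rw [mem_Icc] at hk
    have h2 := hL k hk.1
    have := expSum_mul_lCoeff ψ α β (L := L k) (n := n) (by omega)
    rw [h2] at this
    exact this
  rw [sum_congr rfl h1, sum_comm, lCoeff, mul_sum]
  refine sum_congr rfl fun g hg => ?_
  rw [mem_monics] at hg
  rw [← sum_mul]
  congr 1
  have := sum_card_charPoly_dvd L hL hg.1
  rw [hg.2.1] at this
  exact_mod_cast this.symm

lemma lCoeff_eq_zero (hp3 : 3 < p) (hψ : ψ ≠ 1) (hα : α ≠ 0) {n : ℕ} (hn : 6 ≤ n) :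
    lCoeff ψ α β n = 0 := by
  have h3 : (3 : ZMod p) ≠ 0 := by
    intro h
    have : ((3 : ℕ) : ZMod p) = 0 := by exact_mod_cast h
    rw [ZMod.natCast_eq_zero_iff] at this
    have := Nat.le_of_dvd (by norm_num) this
    omega
  obtain ⟨a, ha⟩ := AddChar.ne_one_iff.1 hψ
  set s : ZMod p := -a / (3 * α) with hs
  have hs3 : -(3 * α * s) = a := by rw [hs]; field_simp
  have hdeg : ∀ c : ZMod p, (C c * X ^ (n - 3) : (ZMod p)[X]).degree < (n : ℕ) := fun c =>
    lt_of_le_of_lt (degree_C_mul_X_pow_le _ _) (by exact_mod_cast (by omega : n - 3 < n))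
  have hmem : ∀ c : ZMod p, ∀ g ∈ monics (ZMod p) n,
      g + C c * X ^ (n - 3) ∈ monics (ZMod p) n := by
    intro c g hg
    rw [mem_monics] at hg ⊢
    have hgd : (C c * X ^ (n - 3) : (ZMod p)[X]).degree < g.degree := by
      rw [degree_eq_natDegree hg.1.ne_zero, hg.2.1]; exact hdeg c
    refine ⟨hg.1.add_of_left hgd, ?_, ?_⟩
    · rw [natDegree_eq_of_degree_eq (degree_add_eq_left_of_degree_lt hgd), hg.2.1]
    · rw [coeff_add, coeff_C_mul_X_pow, if_neg (by omega), add_zero]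
      exact hg.2.2
  have hval : ∀ g ∈ monics (ZMod p) n,
      rootSum α β (g + C s * X ^ (n - 3)) = rootSum α β g + a := by
    intro g hg
    have h1 := mem_monics.1 (hmem s g hg)
    have h2 := mem_monics.1 hg
    simp only [rootSum, coeff_reverse, h1.2.1, h2.2.1, coeff_add, coeff_C_mul_X_pow]
    rw [revAt_le (by omega), revAt_le (by omega), revAt_le (by omega), if_neg (by omega),
      if_neg (by omega), if_pos rfl, if_neg (by omega), if_neg (by omega), if_neg (by omega)]
    rw [← hs3]
    ring
  have hsum : lCoeff ψ α β n = ψ a * lCoeff ψ α β n := by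
    conv_rhs => rw [lCoeff, mul_sum]
    symm
    refine sum_bij' (fun g _ => g + C s * X ^ (n - 3)) (fun g _ => g + C (-s) * X ^ (n - 3))
      (hmem s) (hmem (-s)) ?_ ?_ ?_
    · intro g _; simp
    · intro g _; simp
    · intro g hg
      rw [hval g hg, AddChar.map_add_eq_mul, mul_comm]
  have : (1 - ψ a) * lCoeff ψ α β n = 0 := by rw [sub_mul, one_mul, ← hsum, sub_self]
  rcases mul_eq_zero.1 this with h | h
  · exact absurd (sub_eq_zero.1 h).symm ha
  · exact h

end LFunction

section PowerSums

open Polynomial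

/-- A bound for the power sums of complex numbers bounds the numbers themselves. -/
lemma norm_le_of_power_sum_le {ι : Type*} [Fintype ι] (z : ι → ℂ) {A R : ℝ} (hR : 0 < R)
    (h : ∀ s : ℕ, 0 < s → ‖∑ i, z i ^ s‖ ≤ A * R ^ s) (i : ι) : ‖z i‖ ≤ R := by
  classical
  set g : ℂ[X] := ∏ v ∈ (univ.image z).erase (z i), (X - C v) with hg
  have hgi : g.eval (z i) ≠ 0 := by
    rw [hg, eval_prod, prod_ne_zero_iff]
    intro v hv
    simpa [sub_eq_zero] using (ne_of_mem_erase hv).symm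
  have hgj : ∀ j, z j ≠ z i → g.eval (z j) = 0 := by
    intro j hj
    rw [hg, eval_prod]
    refine prod_eq_zero (mem_erase.2 ⟨hj, mem_image_of_mem _ (mem_univ j)⟩) (by simp)
  set M := ∑ k ∈ range (g.natDegree + 1), ‖g.coeff k‖ * (A * R ^ k) with hM
  have key : ∀ s : ℕ, 0 < s → ‖g.eval (z i)‖ * ‖z i‖ ^ s ≤ M * R ^ s := by
    intro s hs
    have h1 : ∑ j, g.eval (z j) * z j ^ s = #{j | z j = z i} * (g.eval (z i) * z i ^ s) := by
      rw [← nsmul_eq_mul, ← sum_const, sum_filter]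
      refine sum_congr rfl fun j _ => ?_
      split_ifs with hj
      · rw [hj]
      · rw [hgj j hj, zero_mul]
    have h2 : ∑ j, g.eval (z j) * z j ^ s =
        ∑ k ∈ range (g.natDegree + 1), g.coeff k * ∑ j, z j ^ (s + k) := by
      simp_rw [eval_eq_sum_range, sum_mul, mul_sum]
      rw [sum_comm]
      refine sum_congr rfl fun k _ => sum_congr rfl fun j _ => ?_
      ring
    have h3 : (1 : ℝ) ≤ #{j | z j = z i} := by
      exact_mod_cast card_pos.2 ⟨i, by simp⟩
    calc ‖g.eval (z i)‖ * ‖z i‖ ^ s ≤ #{j | z j = z i} * (‖g.eval (z i)‖ * ‖z i‖ ^ s) :=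
          le_mul_of_one_le_left (by positivity) h3
      _ = ‖∑ j, g.eval (z j) * z j ^ s‖ := by rw [h1]; simp
      _ ≤ ∑ k ∈ range (g.natDegree + 1), ‖g.coeff k‖ * (A * R ^ (s + k)) := by
          rw [h2]
          refine (norm_sum_le _ _).trans (sum_le_sum fun k _ => ?_)
          rw [norm_mul]
          exact mul_le_mul_of_nonneg_left (h _ (by omega)) (norm_nonneg _)
      _ = M * R ^ s := by
          rw [hM, sum_mul]
          exact sum_congr rfl fun k _ => by ring
  by_contra! hlt
  have hq : 1 < ‖z i‖ / R := (one_lt_div hR).2 hlt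
  have hgp : 0 < ‖g.eval (z i)‖ := norm_pos_iff.2 hgi
  obtain ⟨s, hs⟩ := pow_unbounded_of_one_lt (M / ‖g.eval (z i)‖) hq
  have hs1 : (‖z i‖ / R) ^ s ≤ (‖z i‖ / R) ^ (s + 1) := pow_le_pow_right₀ hq.le (by omega)
  have := key (s + 1) (by omega)
  have h4 := hs.trans_le hs1
  rw [div_pow, div_lt_div_iff₀ hgp (by positivity)] at h4
  linarith [mul_comm ‖g.eval (z i)‖ (‖z i‖ ^ (s + 1))]

/-- Newton's identities, solved for power sums. -/
lemma exists_roots_of_recurrence (d : ℕ) (c S : ℕ → ℂ) (h0 : c 0 = 1) (hc : ∀ n, d < n → c n = 0)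
    (h : ∀ n : ℕ, n * c n = ∑ k ∈ Icc 1 n, S k * c (n - k)) :
    ∃ w : Fin d → ℂ, ∀ k, 0 < k → S k = -∑ i, w i ^ k := by
  set P : ℂ[X] := ∑ k ∈ range (d + 1), C (c k) * X ^ (d - k) with hP
  have hcoeff : ∀ k ≤ d, P.coeff (d - k) = c k := by
    intro k hk
    rw [hP, finsetSum_coeff, sum_eq_single k]
    · simp
    · intro j hj hjk
      rw [mem_range] at hj
      rw [coeff_C_mul_X_pow, if_neg (by omega)]
    · intro hk'
      exact absurd (mem_range.2 (by omega)) hk'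
  have hdeg : P.natDegree ≤ d := by
    refine natDegree_sum_le_of_forall_le _ _ fun k _ => ?_
    exact (natDegree_C_mul_X_pow_le _ _).trans (by omega)
  have hmonic : P.Monic := monic_of_natDegree_le_of_coeff_eq_one d hdeg (by
    simpa [h0] using hcoeff 0 (Nat.zero_le _))
  have hnd : P.natDegree = d := by
    refine le_antisymm hdeg (le_natDegree_of_ne_zero ?_)
    have := hcoeff 0 (Nat.zero_le _)
    simp only [tsub_zero] at this
    rw [this, h0]
    exact one_ne_zero
  have hsplit := IsAlgClosed.splits P
  have hcard : P.roots.card = d := by rw [← hsplit.natDegree_eq_card_roots, hnd]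
  obtain ⟨w, hw⟩ : ∃ w : Fin d → ℂ, (univ : Finset (Fin d)).val.map w = P.roots := by
    have hl : P.roots.toList.length = d := by rw [Multiset.length_toList, hcard]
    refine ⟨fun i => P.roots.toList.get (i.cast hl.symm), ?_⟩
    rw [Fin.univ_val_map]
    conv_rhs => rw [← Multiset.coe_toList P.roots]
    congr 1
    apply List.ext_get
    · simp [hcard]
    · intro n h1 h2
      simp
  have hesymm : ∀ k, MvPolynomial.aeval w (MvPolynomial.esymm (Fin d) ℂ k) = (-1) ^ k * c k := by
    intro k
    rcases le_or_gt k d with hk | hk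
    · rw [MvPolynomial.aeval_esymm_eq_multiset_esymm, hw, ← hcoeff k hk,
        coeff_eq_esymm_roots_of_card (by rw [hcard, hnd]) (by rw [hnd]; omega), hnd,
        hmonic.leadingCoeff, Nat.sub_sub_self hk, one_mul, ← mul_assoc, ← mul_pow]
      simp
    · rw [MvPolynomial.esymm, powersetCard_eq_empty.2 (by simpa using hk), hc k hk]
      simp
  refine ⟨w, fun k => ?_⟩
  induction k using Nat.strong_induction_on with
  | _ k ih =>
    intro hk
    have hN := congrArg (MvPolynomial.aeval w) (MvPolynomial.mul_esymm_eq_sum (Fin d) ℂ k)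
    simp only [map_mul, map_natCast, map_pow, map_neg, map_one, map_sum, hesymm,
      MvPolynomial.psum, MvPolynomial.aeval_X] at hN
    have hN2 : (k : ℂ) * c k = -∑ j ∈ Icc 1 k, (∑ i, w i ^ j) * c (k - j) := by
      have e1 : ((-1 : ℂ) ^ k) * (-1) ^ k = 1 := by rw [← mul_pow]; simp
      have : (k : ℂ) * c k = (-1) ^ k * (k * ((-1) ^ k * c k)) := by
        linear_combination (-(k : ℂ) * c k) * e1
      rw [this, hN, ← mul_assoc, pow_succ, ← mul_assoc, e1, one_mul, neg_one_mul]
      congr 1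
      refine sum_bij' (fun a _ => a.2) (fun j _ => (k - j, j)) ?_ ?_ ?_ ?_ ?_
      · intro a ha
        rw [mem_filter, HasAntidiagonal.mem_antidiagonal] at ha
        rw [mem_Icc]
        omega
      · intro j hj
        rw [mem_Icc] at hj
        rw [mem_filter, HasAntidiagonal.mem_antidiagonal]
        simp only
        omega
      · intro a ha
        rw [mem_filter, HasAntidiagonal.mem_antidiagonal] at ha
        ext <;> simp only
        omega
      · intro j _
        rfl
      · intro a ha
        rw [mem_filter, HasAntidiagonal.mem_antidiagonal] at ha
        have : k - a.2 = a.1 := by omega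
        rw [this, ← mul_assoc, ← mul_pow]
        simp [mul_comm]
    rw [h k, ← sub_eq_zero, sub_neg_eq_add, ← sum_add_distrib] at hN2
    rw [sum_eq_single k] at hN2
    · rw [Nat.sub_self, h0] at hN2
      linear_combination hN2
    · intro j hj hjk
      rw [mem_Icc] at hj
      rw [ih j (by omega) (by omega)]
      ring
    · intro hk'
      exact absurd (mem_Icc.2 ⟨hk, le_rfl⟩) hk'

end PowerSums

section WeilPrime

variable {p : ℕ} [Fact p.Prime]

lemma expSum_of_finrank_eq_one (ψ : AddChar (ZMod p) ℂ) (K : Type) [Field K] [Fintype K]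
    [DecidableEq K] [Algebra (ZMod p) K] (hK : Module.finrank (ZMod p) K = 1) (α β : ZMod p) :
    expSum ψ K α β = ∑ t : (ZMod p)ˣ, ψ (α * t ^ 3 + β * (t : ZMod p)⁻¹ ^ 2) := by
  have hb : Function.Bijective (algebraMap (ZMod p) K) := by
    refine ⟨(algebraMap (ZMod p) K).injective, ?_⟩
    have := (finrank_eq_one_iff_of_nonzero' (1 : K) one_ne_zero).1 hK
    intro y
    obtain ⟨c, hc⟩ := this y
    exact ⟨c, by rw [← hc, Algebra.smul_def, mul_one]⟩
  symm
  refine Fintype.sum_equiv (Units.mapEquiv (RingEquiv.ofBijective _ hb).toMulEquiv).toEquiv _ _ ?_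
  intro t
  have : algebraMap (ZMod p) K α * (algebraMap (ZMod p) K t) ^ 3 + algebraMap (ZMod p) K β *
      (algebraMap (ZMod p) K t)⁻¹ ^ 2 =
      algebraMap (ZMod p) K (α * t ^ 3 + β * (t : ZMod p)⁻¹ ^ 2) := by
    rw [map_add, map_mul, map_mul, map_pow, map_pow, map_inv₀]
  have h2 := Algebra.trace_algebraMap (R := ZMod p) (S := K)
    (α * t ^ 3 + β * (t : ZMod p)⁻¹ ^ 2)
  rw [← this, hK, one_smul] at h2
  rw [← h2]
  rfl

/-- Weil's bound for `∑ ψ(α t³ + β t⁻²)` over a prime field. -/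
theorem norm_sum_units_le (hp3 : 3 < p) {ψ : AddChar (ZMod p) ℂ} (hψ : ψ ≠ 1) {α : ZMod p}
    (hα : α ≠ 0) (β : ZMod p) :
    ‖∑ t : (ZMod p)ˣ, ψ (α * t ^ 3 + β * (t : ZMod p)⁻¹ ^ 2)‖ ≤ 5 * √p := by
  classical
  let L : ℕ → Type := fun k => GaloisField p k
  let : ∀ k, Field (L k) := fun k => inferInstanceAs (Field (GaloisField p k))
  let : ∀ k, Algebra (ZMod p) (L k) := fun k =>
    inferInstanceAs (Algebra (ZMod p) (GaloisField p k))
  let : ∀ k, Fintype (L k) := fun k => Fintype.ofFinite (GaloisField p k)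
  have hL : ∀ k, 0 < k → Module.finrank (ZMod p) (L k) = k := fun k hk =>
    GaloisField.finrank p hk.ne'
  obtain ⟨w, hw⟩ := exists_roots_of_recurrence 5 (lCoeff ψ α β) (fun k => expSum ψ (L k) α β)
    (lCoeff_zero ψ α β) (fun n hn => lCoeff_eq_zero ψ α β hp3 hψ hα hn)
    (nat_mul_lCoeff ψ α β L hL)
  have hp0 : (0 : ℝ) < p := by exact_mod_cast (Fact.out : p.Prime).pos
  have hbd : ∀ i, ‖w i‖ ≤ √p := by
    intro i
    have := norm_le_of_power_sum_le (fun i => w i ^ 2) (A := stepanovConst p + 1) hp0 ?_ i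
    · rw [norm_pow] at this
      exact Real.le_sqrt_of_sq_le this
    · intro s hs
      have h1 := hw (2 * s) (by omega)
      simp only [← pow_mul]
      rw [← norm_neg, ← h1]
      refine norm_expSum_le hp3 hψ (L (2 * s)) ?_ hα β
      rw [← Nat.card_eq_fintype_card]
      have := GaloisField.card p (2 * s) (by omega)
      rw [← pow_mul, mul_comm s 2]
      exact this
  rw [← expSum_of_finrank_eq_one ψ (L 1) (hL 1 one_pos), hw 1 one_pos, norm_neg]
  simp only [pow_one]
  calc ‖∑ i, w i‖ ≤ ∑ i : Fin 5, √(p : ℝ) := (norm_sum_le _ _).trans (sum_le_sum fun i _ => hbd i)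
    _ = 5 * √p := by simp

end WeilPrime

section UnitSum

variable {R : Type*} [CommRing R]

/-- The effect of the substitution `t ↦ t (1 + y)` for nilpotent `y`. -/
lemma cubic_shift (m n : R) {y : R} (hy : y ^ 3 = 0) (s t : Rˣ) (hs : (s : R) = t * (1 + y)) :
    m * s ^ 3 + n * ((s⁻¹ : Rˣ) : R) ^ 2 = (m * t ^ 3 + n * ((t⁻¹ : Rˣ) : R) ^ 2) +
      (3 * m * t ^ 3 - 2 * n * ((t⁻¹ : Rˣ) : R) ^ 2) * y +
      3 * (m * t ^ 3 + n * ((t⁻¹ : Rˣ) : R) ^ 2) * y ^ 2 := by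
  have hinv : ((s⁻¹ : Rˣ) : R) = ((t⁻¹ : Rˣ) : R) * (1 - y + y ^ 2) := by
    have : (s : R) * (((t⁻¹ : Rˣ) : R) * (1 - y + y ^ 2)) = 1 := by
      rw [hs]
      linear_combination (1 + y ^ 3) * t.mul_inv + hy
    exact Units.inv_eq_of_mul_eq_one_right this
  rw [hs, hinv]
  linear_combination (m * t ^ 3 + n * ((t⁻¹ : Rˣ) : R) ^ 2 * (y - 2)) * hy

variable [Fintype R] [DecidableEq R]

/-- The complete exponential sum `∑ ψ(m t³ + n t⁻²)` over the units of a finite ring. -/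
noncomputable def unitSum (ψ : AddChar R ℂ) (m n : R) : ℂ :=
  ∑ t : Rˣ, ψ (m * t ^ 3 + n * ((t⁻¹ : Rˣ) : R) ^ 2)

lemma sum_addChar_mul {ψ : AddChar R ℂ} (hψ : ψ.IsPrimitive) (b : R) :
    ∑ x, ψ (b * x) = if b = 0 then (Fintype.card R : ℂ) else 0 := by
  have := AddChar.sum_mulShift b hψ
  rw [Nat.cast_ite, Nat.cast_zero] at this
  rw [← this]
  exact sum_congr rfl fun x _ => by rw [mul_comm]

/-- A bound for quadratic Gauss sums over a finite ring. -/
lemma norm_gaussSum_sq_le {ψ : AddChar R ℂ} (hψ : ψ.IsPrimitive) (a b : R) :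
    ‖∑ u, ψ (a * u + b * u ^ 2)‖ ^ 2 ≤ Fintype.card R * #{h : R | 2 * b * h = 0} := by
  have h1 : ((‖∑ u, ψ (a * u + b * u ^ 2)‖ ^ 2 : ℝ) : ℂ) =
      ∑ h, ψ (a * h + b * h ^ 2) * ∑ v, ψ (2 * b * h * v) := by
    rw [Complex.ofReal_pow, ← Complex.mul_conj', map_sum, sum_mul]
    simp_rw [mul_sum]
    rw [sum_comm]
    symm
    rw [sum_comm]
    refine sum_congr rfl fun v _ => ?_
    refine Fintype.sum_equiv (Equiv.addRight v) _ _ fun h => ?_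
    rw [Equiv.coe_addRight, ← AddChar.map_neg_eq_conj, ← AddChar.map_add_eq_mul,
      ← AddChar.map_add_eq_mul]
    congr 1
    ring
  have h2 : ‖∑ h, ψ (a * h + b * h ^ 2) * ∑ v, ψ (2 * b * h * v)‖ ≤
      ∑ h : R, if 2 * b * h = 0 then (Fintype.card R : ℝ) else 0 := by
    refine (norm_sum_le _ _).trans (sum_le_sum fun h _ => ?_)
    rw [sum_addChar_mul hψ, norm_mul, AddChar.norm_apply, one_mul]
    split_ifs <;> simp
  rw [← h1, Complex.norm_real, Real.norm_of_nonneg (by positivity)] at h2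
  refine h2.trans_eq ?_
  rw [← sum_filter, sum_const, nsmul_eq_mul, mul_comm]

/-- Averaging over a subgroup of units. -/
lemma card_mul_unitSum (ψ : AddChar R ℂ) (m n y : R) (hy : y ^ 3 = 0) :
    (Fintype.card R : ℂ) * unitSum ψ m n =
      ∑ t : Rˣ, ψ (m * t ^ 3 + n * ((t⁻¹ : Rˣ) : R) ^ 2) *
        ∑ u, ψ ((3 * m * t ^ 3 - 2 * n * ((t⁻¹ : Rˣ) : R) ^ 2) * y * u +
          3 * (m * t ^ 3 + n * ((t⁻¹ : Rˣ) : R) ^ 2) * y ^ 2 * u ^ 2) := by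
  have hu : ∀ u : R, ∃ w : Rˣ, (w : R) = 1 + y * u := fun u => by
    have : IsUnit (1 + y * u) := by
      refine .of_mul_eq_one (1 - y * u + y ^ 2 * u ^ 2) ?_
      linear_combination u ^ 3 * hy
    exact ⟨this.unit, rfl⟩
  choose w hw using hu
  have h1 : ∀ u : R, unitSum ψ m n = ∑ t : Rˣ, ψ (m * t ^ 3 + n * ((t⁻¹ : Rˣ) : R) ^ 2) *
      ψ ((3 * m * t ^ 3 - 2 * n * ((t⁻¹ : Rˣ) : R) ^ 2) * y * u +
          3 * (m * t ^ 3 + n * ((t⁻¹ : Rˣ) : R) ^ 2) * y ^ 2 * u ^ 2) := by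
    intro u
    symm
    refine Fintype.sum_equiv (Equiv.mulRight (w u)) _ _ fun t => ?_
    rw [← AddChar.map_add_eq_mul, Equiv.coe_mulRight,
      cubic_shift m n (y := y * u) (by rw [mul_pow, hy, zero_mul]) (t * w u) t
        (by rw [Units.val_mul, hw])]
    congr 1
    ring
  simp_rw [mul_sum]
  rw [sum_comm, ← sum_congr rfl fun u _ => h1 u]
  simp

lemma norm_unitSum_le_card (ψ : AddChar R ℂ) (m n : R) : ‖unitSum ψ m n‖ ≤ Fintype.card R := by
  refine (norm_sum_le _ _).trans ?_
  simp only [AddChar.norm_apply, sum_const, nsmul_eq_mul, mul_one]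
  exact_mod_cast Fintype.card_le_of_injective _ Units.val_injective

lemma card_filter_units_pow_le (j : ℕ) (T : R → Prop) [DecidablePred T] :
    #{w : Rˣ | T ((w : R) ^ j)} ≤ #{w : Rˣ | w ^ j = 1} * #{x : R | T x} := by
  have h := card_le_mul_card_image (f := fun w : Rˣ => w ^ j) ({w : Rˣ | T ((w : R) ^ j)})
    #{w : Rˣ | w ^ j = 1} ?_
  · refine h.trans (Nat.mul_le_mul_left _ ?_)
    refine card_le_card_of_injOn (fun w => (w : R)) ?_ Units.val_injective.injOn
    intro w hw
    simp only [coe_image, Set.mem_image, mem_coe, mem_filter, mem_univ, true_and] at hw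
    obtain ⟨v, hv, rfl⟩ := hw
    simpa using hv
  · intro a ha
    rw [mem_image] at ha
    obtain ⟨v, _, rfl⟩ := ha
    refine card_le_card_of_injOn (fun w => w * v⁻¹) ?_ (mul_left_injective _).injOn
    intro w hw
    simp only [mem_coe, mem_filter, mem_univ, true_and] at hw ⊢
    rw [mul_pow, hw.2, ← mul_pow]
    simp

end UnitSum

section RootCount

lemma card_mul_eq_zero_le {q : ℕ} [NeZero q] (a : ℕ) (ha : 0 < a) :
    #{x : ZMod q | (a : ZMod q) * x = 0} ≤ a := by
  have hd : ∀ x : ZMod q, (a : ZMod q) * x = 0 → q ∣ a * x.val := by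
    intro x hx
    rw [← ZMod.natCast_eq_zero_iff]
    push_cast
    rwa [ZMod.natCast_zmod_val]
  conv_rhs => rw [← card_range a]
  refine card_le_card_of_injOn (fun x => a * x.val / q) ?_ ?_
  · intro x _
    simp only [coe_range, Set.mem_Iio]
    exact Nat.div_lt_of_lt_mul (by rw [mul_comm]; exact Nat.mul_lt_mul_of_pos_right x.val_lt ha)
  · intro x hx z hz hxz
    simp only [coe_filter, mem_univ, true_and, Set.mem_ofPred_eq] at hx hz hxz
    have h1 := (Nat.div_left_inj (hd x hx) (hd z hz)).1 hxz
    exact ZMod.val_injective q (Nat.eq_of_mul_eq_mul_left ha h1)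

lemma card_pow_eq_one_prime_pow {p : ℕ} (hp : p.Prime) (k : ℕ) [NeZero (p ^ k)] {j : ℕ}
    (hj : j = 2 ∨ j = 3 ∨ j = 5) : #{t : (ZMod (p ^ k))ˣ | t ^ j = 1} ≤ 5 := by
  rcases eq_or_ne p 2 with rfl | hp2
  · rcases hj with rfl | hj
    · rcases Nat.eq_zero_or_pos k with rfl | hk
      · refine (card_le_univ _).trans ?_
        have : Fintype.card (ZMod (2 ^ 0))ˣ ≤ Fintype.card (ZMod (2 ^ 0)) :=
          Fintype.card_le_of_injective _ Units.val_injective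
        rw [ZMod.card] at this
        omega
      · have key : ∀ t : (ZMod (2 ^ k))ˣ, t ^ 2 = 1 → ((2 : ℕ) : ZMod (2 ^ k)) * (t - 1) = 0 ∨
            ((2 : ℕ) : ZMod (2 ^ k)) * (t + 1) = 0 := by
          intro t ht
          set a : ℤ := ((t : ZMod (2 ^ k)).val : ℤ) with ha
          have hta : ((t : ZMod (2 ^ k))) = (a : ℤ) := by simp [ha]
          have h2 : ((2 ^ k : ℕ) : ℤ) ∣ (a - 1) * (a + 1) := by
            rw [← ZMod.intCast_zmod_eq_zero_iff_dvd]
            push_cast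
            rw [← hta]
            have : (t : ZMod (2 ^ k)) ^ 2 = 1 := by
              rw [← Units.val_pow_eq_pow_val, ht, Units.val_one]
            linear_combination this
          have hdiv : ∀ z : ℤ, (2 : ℤ) ^ (k - 1) ∣ z → (2 : ZMod (2 ^ k)) * (z : ZMod (2 ^ k)) = 0 := by
            rintro _ ⟨c, rfl⟩
            have h3 : (2 : ZMod (2 ^ k)) ^ k = 0 := by
              have := ZMod.natCast_self (2 ^ k)
              push_cast at this
              exact this
            have h4 : (2 : ZMod (2 ^ k)) * 2 ^ (k - 1) = 2 ^ k := by
              rw [← pow_succ']; congr 1; omega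
            push_cast
            rw [← mul_assoc, h4, h3, zero_mul]
          have h2' : (2 : ℤ) ^ k ∣ (a - 1) * (a + 1) := by exact_mod_cast h2
          have hor : (2 : ℤ) ^ (k - 1) ∣ (a - 1) ∨ (2 : ℤ) ^ (k - 1) ∣ (a + 1) := by
            have hp2 : Prime (2 : ℤ) := Int.prime_two
            by_cases h4 : (2 : ℤ) ∣ (a - 1)
            · obtain ⟨b, hb⟩ := h4
              have e1 : a + 1 = 2 * (b + 1) := by omega
              rw [hb, e1]
              have h5 : (2 : ℤ) ^ (k - 1) ∣ 2 * (b * (b + 1)) := by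
                rw [hb, e1] at h2'
                have : (2 : ℤ) ^ k = 2 * 2 ^ (k - 1) := by rw [← pow_succ']; congr 1; omega
                rw [this, show 2 * b * (2 * (b + 1)) = 2 * (2 * (b * (b + 1))) by ring] at h2'
                exact (mul_dvd_mul_iff_left two_ne_zero).1 h2'
              by_cases hb2 : (2 : ℤ) ∣ b
              · left
                have hc : IsCoprime ((2 : ℤ) ^ (k - 1)) (b + 1) := by
                  apply IsCoprime.pow_left
                  rw [Int.prime_two.coprime_iff_not_dvd]
                  omega
                rw [← mul_assoc] at h5
                exact hc.dvd_of_dvd_mul_right h5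
              · right
                have hc : IsCoprime ((2 : ℤ) ^ (k - 1)) b := by
                  apply IsCoprime.pow_left
                  rw [Int.prime_two.coprime_iff_not_dvd]
                  omega
                rw [show 2 * (b * (b + 1)) = (2 * (b + 1)) * b by ring] at h5
                exact hc.dvd_of_dvd_mul_right h5
            · left
              have hc : IsCoprime ((2 : ℤ) ^ k) (a + 1) := by
                apply IsCoprime.pow_left
                rw [Int.prime_two.coprime_iff_not_dvd]
                omega
              exact (pow_dvd_pow _ (by omega)).trans (hc.dvd_of_dvd_mul_right h2')
          rcases hor with h | h
          · left
            have := hdiv _ h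
            push_cast at this ⊢
            rw [hta, this]
          · right
            have := hdiv _ h
            push_cast at this ⊢
            rw [hta, this]
        calc #{t : (ZMod (2 ^ k))ˣ | t ^ 2 = 1}
            ≤ #(((univ.filter fun x : ZMod (2 ^ k) => ((2 : ℕ) : ZMod (2 ^ k)) * x = 0).image (· + 1)) ∪
              ((univ.filter fun x : ZMod (2 ^ k) => ((2 : ℕ) : ZMod (2 ^ k)) * x = 0).image (· - 1))) := by
              refine card_le_card_of_injOn (fun t => (t : ZMod (2 ^ k))) ?_ Units.val_injective.injOn
              intro t ht
              simp only [coe_filter, mem_univ, true_and, Set.mem_ofPred_eq] at ht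
              simp only [mem_coe, mem_union, mem_image, mem_filter, mem_univ, true_and]
              rcases key t ht with h | h
              · exact Or.inl ⟨_, h, by ring⟩
              · exact Or.inr ⟨_, h, by ring⟩
          _ ≤ 2 + 2 := (card_union_le _ _).trans (add_le_add
              (card_image_le.trans (card_mul_eq_zero_le 2 two_pos))
              (card_image_le.trans (card_mul_eq_zero_le 2 two_pos)))
          _ ≤ 5 := by norm_num
    · have hjp : j.Prime ∧ j ≠ 2 := by rcases hj with rfl | rfl <;> norm_num
      have : ({t : (ZMod (2 ^ k))ˣ | t ^ j = 1} : Finset _) ⊆ {1} := by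
        intro t ht
        simp only [mem_filter, mem_univ, true_and, mem_singleton] at ht ⊢
        rcases Nat.eq_zero_or_pos k with rfl | hk
        · have : Subsingleton (ZMod (2 ^ 0)) := by
            rw [pow_zero]; infer_instance
          exact Subsingleton.elim _ _
        have h1 : orderOf t ∣ 2 ^ (k - 1) := by
          have := orderOf_dvd_card (x := t)
          rw [ZMod.card_units_eq_totient, Nat.totient_prime_pow Nat.prime_two hk] at this
          simpa using this
        have h2 := orderOf_dvd_of_pow_eq_one ht
        have h3 : Nat.Coprime (2 ^ (k - 1)) j :=
          Nat.Coprime.pow_left _ ((Nat.coprime_primes Nat.prime_two hjp.1).2 hjp.2.symm)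
        exact orderOf_eq_one_iff.1 (Nat.eq_one_of_dvd_coprimes h3 h1 h2)
      exact (card_le_card this).trans (by simp)
  · have hc : IsCyclic (ZMod (p ^ k))ˣ := ZMod.isCyclic_units_of_prime_pow p hp hp2 k
    have := IsCyclic.card_pow_eq_one_le (α := (ZMod (p ^ k))ˣ) (n := j) (by omega)
    refine le_trans ?_ (this.trans (by omega))
    exact le_of_eq (by congr)

end RootCount

section PrimePower

lemma isUnit_intCast_of_not_dvd {p : ℕ} (hp : p.Prime) (k : ℕ) {m : ℤ} (hm : ¬ (p : ℤ) ∣ m) :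
    IsUnit (m : ZMod (p ^ k)) := by
  rw [ZMod.coe_int_isUnit_iff_isCoprime]
  push_cast
  exact ((Nat.prime_iff_prime_int.1 hp).coprime_iff_not_dvd.2 hm).pow_left

lemma card_le_of_forall_mul_pow {p : ℕ} (hp : p.Prime) (k : ℕ) [NeZero (p ^ k)] (a : ℕ)
    (ha : 0 < a) (T : Finset (ZMod (p ^ k))ˣ)
    (hT : ∀ t ∈ T, ∀ s ∈ T, (a : ZMod (p ^ k)) * (((t * s⁻¹ : (ZMod (p ^ k))ˣ) : ZMod (p ^ k)) ^ 5
      - 1) = 0) : #T ≤ 5 * a := by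
  rcases T.eq_empty_or_nonempty with rfl | ⟨s, hs⟩
  · simp
  calc #T ≤ #{w : (ZMod (p ^ k))ˣ | (a : ZMod (p ^ k)) * ((w : ZMod (p ^ k)) ^ 5 - 1) = 0} := by
        refine card_le_card_of_injOn (fun t => t * s⁻¹) ?_ (mul_left_injective _).injOn
        intro t ht
        simpa using hT t ht s hs
    _ ≤ #{w : (ZMod (p ^ k))ˣ | w ^ 5 = 1} * #{x : ZMod (p ^ k) | (a : ZMod (p ^ k)) * (x - 1) = 0} :=
        card_filter_units_pow_le 5 (fun x => (a : ZMod (p ^ k)) * (x - 1) = 0)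
    _ ≤ 5 * a := by
        refine Nat.mul_le_mul (card_pow_eq_one_prime_pow hp k (by omega)) ?_
        refine le_trans ?_ (card_mul_eq_zero_le (q := p ^ k) a ha)
        refine card_le_card_of_injOn (fun x => x - 1) ?_ (sub_left_injective).injOn
        intro x hx
        simpa using hx

/-- Stationary phase: the bound for proper prime powers. -/
theorem norm_unitSum_prime_pow_le {p : ℕ} (hp : p.Prime) {k : ℕ} (hk : 2 ≤ k) [NeZero (p ^ k)]
    {ψ : AddChar (ZMod (p ^ k)) ℂ} (hψ : ψ.IsPrimitive) {m n : ℤ}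
    (hmn : ¬ ((p : ℤ) ∣ m ∧ (p : ℤ) ∣ n)) :
    ‖unitSum ψ (m : ZMod (p ^ k)) n‖ ≤ 165 * √((p ^ k : ℕ) : ℝ) := by
  classical
  obtain ⟨i, j, hij, hji, h2j, hj⟩ : ∃ i j : ℕ, i + j = k ∧ j ≤ i ∧ i ≤ 2 * j ∧ i ≤ j + 1 :=
    ⟨k - k / 2, k / 2, by omega, by omega, by omega, by omega⟩
  set P : ZMod (p ^ k) := (p : ZMod (p ^ k)) with hP
  have hPk : P ^ k = 0 := by
    have := ZMod.natCast_self (p ^ k)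
    push_cast at this
    exact this
  have hPz : ∀ e, k ≤ e → P ^ e = 0 := fun e he => by
    rw [← Nat.sub_add_cancel he, pow_add, hPk, mul_zero]
  have hp0 : 0 < p := hp.pos
  set f : (ZMod (p ^ k))ˣ → ZMod (p ^ k) := fun t =>
    m * t ^ 3 + n * ((t⁻¹ : (ZMod (p ^ k))ˣ) : ZMod (p ^ k)) ^ 2 with hf
  set g : (ZMod (p ^ k))ˣ → ZMod (p ^ k) := fun t =>
    3 * m * t ^ 3 - 2 * n * ((t⁻¹ : (ZMod (p ^ k))ˣ) : ZMod (p ^ k)) ^ 2 with hg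
  set G : (ZMod (p ^ k))ˣ → ℂ := fun t => ∑ u, ψ (g t * P ^ j * u + 3 * f t * (P ^ j) ^ 2 * u ^ 2)
    with hG
  have hmain := card_mul_unitSum ψ (m : ZMod (p ^ k)) n (P ^ j)
    (by rw [← pow_mul]; exact hPz _ (by omega))
  rw [ZMod.card] at hmain
  change _ = ∑ t, ψ (f t) * G t at hmain
  set T : Finset (ZMod (p ^ k))ˣ := {t | P ^ i * g t = 0} with hT
  have hG0 : ∀ t, t ∉ T → G t = 0 := by
    intro t ht
    by_contra hne
    apply ht
    rw [hT, mem_filter]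
    refine ⟨mem_univ _, ?_⟩
    by_contra hne2
    apply hψ hne2
    ext y
    rw [AddChar.mulShift_apply, AddChar.one_apply]
    have h1 : ψ (P ^ i * g t * y) * G t = G t := by
      rw [hG]
      simp only
      rw [mul_sum]
      refine Fintype.sum_equiv (Equiv.addRight (P ^ (i - j) * y)) _ _ fun u => ?_
      rw [Equiv.coe_addRight, ← AddChar.map_add_eq_mul]
      congr 1
      have e1 : P ^ j * P ^ (i - j) = P ^ i := by rw [← pow_add]; congr 1; omega
      have e2 : P ^ j * P ^ i = 0 := by rw [← pow_add]; exact hPz _ (by omega)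
      have e3 : P ^ i * P ^ i = 0 := by rw [← pow_add]; exact hPz _ (by omega)
      linear_combination (-(g t * y) - 6 * f t * P ^ j * u * y - 3 * f t * y ^ 2 *
        (P ^ j * P ^ (i - j) + P ^ i)) * e1 - 6 * f t * u * y * e2 - 3 * f t * y ^ 2 * e3
    have h2 : (ψ (P ^ i * g t * y) - 1) * G t = 0 := by rw [sub_mul, h1, one_mul, sub_self]
    exact sub_eq_zero.1 ((mul_eq_zero.1 h2).resolve_right hne)
  have hTcard : #T ≤ 5 * (6 * p ^ i) := by
    refine card_le_of_forall_mul_pow hp k _ (by positivity) T fun t ht s hs => ?_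
    rw [hT, mem_filter] at ht hs
    have ht2 : P ^ i * (3 * m * t ^ 5) = P ^ i * (2 * n) := by
      have := ht.2
      simp only [hg] at this
      linear_combination (t : ZMod (p ^ k)) ^ 2 * this + 2 * n * P ^ i *
        (t * ((t⁻¹ : (ZMod (p ^ k))ˣ) : ZMod (p ^ k)) + 1) * t.mul_inv
    have hs2 : P ^ i * (3 * m * s ^ 5) = P ^ i * (2 * n) := by
      have := hs.2
      simp only [hg] at this
      linear_combination (s : ZMod (p ^ k)) ^ 2 * this + 2 * n * P ^ i *
        (s * ((s⁻¹ : (ZMod (p ^ k))ˣ) : ZMod (p ^ k)) + 1) * s.mul_inv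
    set w : (ZMod (p ^ k))ˣ := t * s⁻¹ with hw
    have htw : (t : ZMod (p ^ k)) = w * s := by rw [← Units.val_mul, hw]; simp
    have key : (s : ZMod (p ^ k)) ^ 5 * (m * (P ^ i * 3 * ((w : ZMod (p ^ k)) ^ 5 - 1))) = 0 := by
      rw [htw] at ht2
      linear_combination ht2 - hs2
    have key2 : (m : ZMod (p ^ k)) * (P ^ i * 3 * ((w : ZMod (p ^ k)) ^ 5 - 1)) = 0 :=
      ((s.isUnit.pow 5).mul_right_eq_zero).1 key
    push_cast
    by_cases hm : (p : ℤ) ∣ m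
    · have hn := isUnit_intCast_of_not_dvd hp k (fun h => hmn ⟨hm, h⟩)
      have : (n : ZMod (p ^ k)) * (P ^ i * 2 * ((w : ZMod (p ^ k)) ^ 5 - 1)) = 0 := by
        linear_combination s ^ 5 * key2 - ((w : ZMod (p ^ k)) ^ 5 - 1) * hs2
      have := hn.mul_right_eq_zero.1 this
      linear_combination 3 * this
    · have hm := isUnit_intCast_of_not_dvd hp k hm
      have := hm.mul_right_eq_zero.1 key2
      linear_combination 2 * this
  have hGT : ∀ t ∈ T, ‖G t‖ ^ 2 ≤ 30 * ((p : ℝ) ^ k * (p : ℝ) ^ (2 * j)) := by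
    intro t ht
    rw [hT, mem_filter] at ht
    refine (norm_gaussSum_sq_le hψ _ _).trans ?_
    have hc : #{h : ZMod (p ^ k) | 2 * (3 * f t * (P ^ j) ^ 2) * h = 0} ≤ 30 * p ^ (2 * j) := by
      refine le_trans (card_le_card ?_) (card_mul_eq_zero_le (q := p ^ k) (30 * p ^ (2 * j))
        (by positivity))
      intro h hh
      rw [mem_filter] at hh ⊢
      refine ⟨mem_univ _, ?_⟩
      have e1 : P ^ (2 * j) * g t = 0 := by
        rw [← Nat.sub_add_cancel h2j, pow_add, mul_assoc, ht.2, mul_zero]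
      have e2 : 6 * P ^ (2 * j) * f t * h = 0 := by
        rw [mul_comm 2 j, pow_mul]
        linear_combination hh.2
      push_cast
      by_cases hm : (p : ℤ) ∣ m
      · have hn := isUnit_intCast_of_not_dvd hp k (fun h => hmn ⟨hm, h⟩)
        have e3 : (n * ((t⁻¹ : (ZMod (p ^ k))ˣ) : ZMod (p ^ k)) ^ 2) * (30 * P ^ (2 * j) * h) = 0 := by
          simp only [hf, hg] at e1 e2
          linear_combination 3 * e2 - 6 * h * e1
        exact (hn.mul ((t⁻¹).isUnit.pow 2)).mul_right_eq_zero.1 e3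
      · have hm := isUnit_intCast_of_not_dvd hp k hm
        have e3 : (m * (t : ZMod (p ^ k)) ^ 3) * (30 * P ^ (2 * j) * h) = 0 := by
          simp only [hf, hg] at e1 e2
          linear_combination 2 * e2 + 6 * h * e1
        exact (hm.mul (t.isUnit.pow 3)).mul_right_eq_zero.1 e3
    have hc' : (#{h : ZMod (p ^ k) | 2 * (3 * f t * (P ^ j) ^ 2) * h = 0} : ℝ) ≤
        30 * (p : ℝ) ^ (2 * j) := by exact_mod_cast hc
    rw [ZMod.card]
    push_cast
    nlinarith [pow_pos (show (0 : ℝ) < p by exact_mod_cast hp0) k]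
  have hpR : (0 : ℝ) < p := by exact_mod_cast hp0
  have hbound : (p : ℝ) ^ k * ‖unitSum ψ (m : ZMod (p ^ k)) n‖ ≤
      30 * (p : ℝ) ^ i * √(30 * ((p : ℝ) ^ k * (p : ℝ) ^ (2 * j))) := by
    have h1 : (p : ℝ) ^ k * ‖unitSum ψ (m : ZMod (p ^ k)) n‖ = ‖∑ t, ψ (f t) * G t‖ := by
      rw [← hmain, norm_mul]
      simp
    rw [h1, ← sum_subset (subset_univ T) fun t _ ht => by rw [hG0 t ht, mul_zero]]
    refine (norm_sum_le _ _).trans ?_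
    calc ∑ t ∈ T, ‖ψ (f t) * G t‖
        ≤ ∑ t ∈ T, √(30 * ((p : ℝ) ^ k * (p : ℝ) ^ (2 * j))) := by
          refine sum_le_sum fun t ht => ?_
          rw [norm_mul, AddChar.norm_apply, one_mul]
          exact Real.le_sqrt_of_sq_le (hGT t ht)
      _ ≤ _ := by
          rw [sum_const, nsmul_eq_mul]
          refine mul_le_mul_of_nonneg_right ?_ (Real.sqrt_nonneg _)
          have : (#T : ℝ) ≤ 5 * (6 * (p : ℝ) ^ i) := by exact_mod_cast hTcard
          linarith
  have hs : √(30 * ((p : ℝ) ^ k * (p : ℝ) ^ (2 * j))) = √30 * (√((p : ℝ) ^ k) * p ^ j) := by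
    rw [Real.sqrt_mul (by norm_num), Real.sqrt_mul (by positivity), mul_comm 2 j, pow_mul,
      Real.sqrt_sq (by positivity)]
  have h30 : √(30 : ℝ) ≤ 5.5 := by
    rw [Real.sqrt_le_left (by norm_num)]
    norm_num
  rw [hs, show 30 * (p : ℝ) ^ i * (√30 * (√((p : ℝ) ^ k) * p ^ j)) =
    (p : ℝ) ^ k * (30 * √30 * √((p : ℝ) ^ k)) by rw [← hij, pow_add]; ring] at hbound
  have := le_of_mul_le_mul_left hbound (pow_pos hpR k)
  push_cast
  nlinarith [Real.sqrt_nonneg ((p : ℝ) ^ k)]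

/-- The bound for prime moduli. -/
theorem norm_unitSum_prime_le {p : ℕ} (hp : p.Prime) [NeZero p]
    {ψ : AddChar (ZMod p) ℂ} (hψ : ψ.IsPrimitive) {m n : ℤ}
    (hmn : ¬ ((p : ℤ) ∣ m ∧ (p : ℤ) ∣ n)) :
    ‖unitSum ψ (m : ZMod p) n‖ ≤ 5 * √(p : ℝ) := by
  have : Fact p.Prime := ⟨hp⟩
  have hp1 : (1 : ℝ) ≤ p := by exact_mod_cast hp.one_le
  have hs1 : 1 ≤ √(p : ℝ) := Real.one_le_sqrt.2 hp1
  have hss : √(p : ℝ) * √p = p := Real.mul_self_sqrt (by positivity)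
  rcases le_or_gt p 3 with h3 | h3
  · have := norm_unitSum_le_card ψ (m : ZMod p) n
    rw [ZMod.card] at this
    have h3' : (p : ℝ) ≤ 3 := by exact_mod_cast h3
    nlinarith
  have hψ1 : ψ ≠ 1 := by
    intro h
    apply hψ (one_ne_zero)
    rw [h]
    ext
    simp
  by_cases hm : (p : ℤ) ∣ m
  · have hn : (n : ZMod p) ≠ 0 := by
      rw [Ne, ZMod.intCast_zmod_eq_zero_iff_dvd]
      exact fun h => hmn ⟨hm, h⟩
    have hm0 : (m : ZMod p) = 0 := (ZMod.intCast_zmod_eq_zero_iff_dvd _ _).2 hm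
    have h1 : unitSum ψ (m : ZMod p) n = ∑ u : ZMod p, ψ (0 * u + n * u ^ 2) - 1 := by
      have h2 : unitSum ψ (m : ZMod p) n = ∑ u : (ZMod p)ˣ, ψ (0 * u + n * (u : ZMod p) ^ 2) := by
        refine Fintype.sum_equiv (Equiv.inv _) _ _ fun t => ?_
        rw [hm0, zero_mul, zero_mul, Equiv.inv_apply]
      have h3 : ψ (0 * 0 + n * 0 ^ 2) = 1 := by
        rw [zero_mul, zero_pow two_ne_zero, mul_zero, add_zero, AddChar.map_zero_eq_one]
      rw [h2, ← h3, ← sum_erase_eq_sub (mem_univ 0)]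
      refine sum_bij (fun u _ => (u : ZMod p)) ?_ ?_ ?_ ?_
      · intro u _
        exact mem_erase.2 ⟨u.ne_zero, mem_univ _⟩
      · intro u _ v _ h
        exact Units.ext h
      · intro u hu
        exact ⟨Units.mk0 u (ne_of_mem_erase hu), mem_univ _, rfl⟩
      · intro u _
        rfl
    have h4 := norm_gaussSum_sq_le hψ 0 (n : ZMod p)
    have h5 : #{h : ZMod p | 2 * (n : ZMod p) * h = 0} = 1 := by
      rw [card_eq_one]
      refine ⟨0, ?_⟩
      ext h
      have h2 : (2 : ZMod p) ≠ 0 := by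
        intro h2
        have : ((2 : ℕ) : ZMod p) = 0 := by exact_mod_cast h2
        rw [ZMod.natCast_eq_zero_iff] at this
        have := Nat.le_of_dvd (by norm_num) this
        omega
      rw [mem_filter, mem_singleton, mul_eq_zero_iff_left (mul_ne_zero h2 hn)]
      exact and_iff_right (mem_univ _)
    rw [h5, ZMod.card, Nat.cast_one, mul_one] at h4
    have h6 := Real.le_sqrt_of_sq_le h4
    rw [h1]
    refine (norm_sub_le _ _).trans ?_
    rw [norm_one]
    linarith
  · have hm0 : (m : ZMod p) ≠ 0 := by
      rwa [Ne, ZMod.intCast_zmod_eq_zero_iff_dvd]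
    have := norm_sum_units_le h3 hψ1 hm0 (n : ZMod p)
    simp only [unitSum, Units.val_inv_eq_inv_val]
    exact this

end PrimePower

section Reduction

lemma exists_primitive_reduction {p : ℕ} (hp : p.Prime) (k : ℕ) [NeZero (p ^ k)]
    [NeZero (p ^ (k + 1))] {ψ : AddChar (ZMod (p ^ (k + 1))) ℂ} (hψ : ψ.IsPrimitive) :
    ∃ ψ' : AddChar (ZMod (p ^ k)) ℂ, ψ'.IsPrimitive ∧ ∀ m n : ℤ,
      ‖unitSum ψ ((p * m : ℤ) : ZMod (p ^ (k + 1))) ((p * n : ℤ) : ZMod (p ^ (k + 1)))‖ ≤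
        p * ‖unitSum ψ' (m : ZMod (p ^ k)) n‖ := by
  classical
  have hdvd : p ^ k ∣ p ^ (k + 1) := pow_dvd_pow _ (by omega)
  have hpk : (p : ZMod (p ^ (k + 1))) * p ^ k = 0 := by
    have := ZMod.natCast_self (p ^ (k + 1))
    push_cast at this
    rw [← pow_succ', this]
  let π := ZMod.castHom hdvd (ZMod (p ^ k))
  let φ : ZMod (p ^ k) →+ ZMod (p ^ (k + 1)) := ZMod.lift (p ^ k)
    ⟨(AddMonoidHom.mulLeft (p : ZMod (p ^ (k + 1)))).comp (Int.castAddHom _), by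
      simpa using hpk⟩
  have hφ : ∀ z : ℤ, φ (z : ZMod (p ^ k)) = (p : ZMod (p ^ (k + 1))) * z := fun z => by
    simp only [φ, ZMod.lift_coe]
    rfl
  have hφπ : ∀ x, φ (π x) = p * x := by
    intro x
    obtain ⟨z, rfl⟩ := ZMod.intCast_surjective x
    rw [map_intCast, hφ]
  refine ⟨ψ.compAddMonoidHom φ, ?_, ?_⟩
  · intro x hx h
    obtain ⟨z, rfl⟩ := ZMod.intCast_surjective x
    have hne : (p : ZMod (p ^ (k + 1))) * z ≠ 0 := by
      intro h0
      apply hx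
      rw [ZMod.intCast_zmod_eq_zero_iff_dvd]
      have : ((p * z : ℤ) : ZMod (p ^ (k + 1))) = 0 := by exact_mod_cast h0
      rw [ZMod.intCast_zmod_eq_zero_iff_dvd, pow_succ'] at this
      push_cast at this ⊢
      exact (mul_dvd_mul_iff_left (by exact_mod_cast hp.ne_zero)).1 this
    apply hψ hne
    ext y
    have := DFunLike.congr_fun h (π y)
    rw [AddChar.mulShift_apply, AddChar.compAddMonoidHom_apply, AddChar.one_apply] at this
    rw [AddChar.mulShift_apply, AddChar.one_apply, ← this]
    congr 1
    rw [← map_intCast π z, ← map_mul, hφπ, mul_assoc]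
  · intro m n
    let ρ := ZMod.unitsMap hdvd
    have hρ := ZMod.unitsMap_surjective hdvd
    set F : (ZMod (p ^ k))ˣ → ℂ := fun s => (ψ.compAddMonoidHom φ)
      (m * s ^ 3 + n * ((s⁻¹ : (ZMod (p ^ k))ˣ) : ZMod (p ^ k)) ^ 2) with hF
    have h1 : unitSum ψ ((p * m : ℤ) : ZMod (p ^ (k + 1))) ((p * n : ℤ) : ZMod (p ^ (k + 1))) =
        ∑ t, F (ρ t) := by
      refine sum_congr rfl fun t _ => ?_
      simp only [hF, AddChar.compAddMonoidHom_apply]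
      congr 1
      have e1 : ((ρ t : (ZMod (p ^ k))ˣ) : ZMod (p ^ k)) = π t := rfl
      have e2 : (((ρ t)⁻¹ : (ZMod (p ^ k))ˣ) : ZMod (p ^ k)) =
          π ((t⁻¹ : (ZMod (p ^ (k + 1)))ˣ) : ZMod (p ^ (k + 1))) := by
        rw [← map_inv]; rfl
      rw [e1, e2, ← map_intCast π m, ← map_intCast π n, ← map_pow, ← map_pow, ← map_mul,
        ← map_mul, ← map_add, hφπ]
      push_cast
      ring
    have hcard : ∀ s, #{t | ρ t = s} = #{t | ρ t = 1} := fun s =>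
      MonoidHom.card_fiber_eq_of_mem_range ρ (hρ s) (hρ 1)
    have h2 : ∑ t, F (ρ t) = #{t | ρ t = 1} * unitSum (ψ.compAddMonoidHom φ) m n := by
      rw [← sum_fiberwise univ ρ, unitSum, mul_sum]
      refine sum_congr rfl fun s _ => ?_
      rw [sum_congr rfl fun t ht => by rw [(mem_filter.1 ht).2], sum_const, hcard, nsmul_eq_mul]
    have h3 : #{t | ρ t = 1} ≤ p := by
      refine le_trans ?_ (card_mul_eq_zero_le (q := p ^ (k + 1)) p hp.pos)
      refine card_le_card_of_injOn (fun t => (t : ZMod (p ^ (k + 1))) - 1) ?_ ?_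
      · intro t ht
        simp only [coe_filter, mem_univ, true_and, Set.mem_ofPred_eq] at ht ⊢
        have e : π (t : ZMod (p ^ (k + 1))) = 1 := by
          have := congrArg Units.val ht
          exact this
        rw [← hφπ, map_sub, e, map_one, sub_self, map_zero]
      · intro t _ s _ h
        exact Units.ext (sub_left_injective h)
    rw [h1, h2, norm_mul, Complex.norm_natCast]
    gcongr

theorem norm_unitSum_pow_le {p : ℕ} (hp : p.Prime) (k : ℕ) [NeZero (p ^ k)]
    {ψ : AddChar (ZMod (p ^ k)) ℂ} (hψ : ψ.IsPrimitive) (m n : ℤ) :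
    ‖unitSum ψ (m : ZMod (p ^ k)) n‖ ≤
      165 * √((p ^ k : ℕ) : ℝ) * √(((m.gcd n).gcd (p ^ k) : ℕ) : ℝ) := by
  have : NeZero p := ⟨hp.ne_zero⟩
  have aux : ∀ q [NeZero q], q = p → ∀ ψ : AddChar (ZMod q) ℂ, ψ.IsPrimitive → ∀ m n : ℤ,
      ¬ ((p : ℤ) ∣ m ∧ (p : ℤ) ∣ n) → ‖unitSum ψ (m : ZMod q) n‖ ≤ 5 * √(q : ℝ) := by
    rintro q _ rfl ψ hψ m n h
    exact norm_unitSum_prime_le hp hψ h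
  suffices main : ∀ k, ∀ ψ : AddChar (ZMod (p ^ k)) ℂ, ψ.IsPrimitive → ∀ m n : ℤ,
      ‖unitSum ψ (m : ZMod (p ^ k)) n‖ ≤
        165 * √((p ^ k : ℕ) : ℝ) * √(((m.gcd n).gcd (p ^ k) : ℕ) : ℝ) from main k ψ hψ m n
  clear hψ ψ m n
  intro k
  induction k with
  | zero =>
    intro ψ _ m n
    refine (norm_unitSum_le_card _ _ _).trans ?_
    rw [ZMod.card]
    simp
  | succ k ih =>
    intro ψ hψ m n
    by_cases hmn : (p : ℤ) ∣ m ∧ (p : ℤ) ∣ n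
    · obtain ⟨⟨m, rfl⟩, ⟨n, rfl⟩⟩ := hmn
      obtain ⟨ψ', hψ', h⟩ := exists_primitive_reduction hp k hψ
      refine (h m n).trans ?_
      have hg : (((p * m : ℤ).gcd (p * n)).gcd (p ^ (k + 1))) = p * (m.gcd n).gcd (p ^ k) := by
        rw [Int.gcd_mul_left, Int.natAbs_natCast, pow_succ', Nat.gcd_mul_left]
      have hss : √(p : ℝ) * √p = p := Real.mul_self_sqrt (by positivity)
      have := ih ψ' hψ' m n
      rw [hg, pow_succ']
      push_cast at this ⊢
      rw [Real.sqrt_mul (by positivity), Real.sqrt_mul (by positivity)]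
      calc (p : ℝ) * ‖unitSum ψ' (m : ZMod (p ^ k)) n‖ ≤ p * (165 * √((p : ℝ) ^ k) *
            √((m.gcd n).gcd (p ^ k) : ℝ)) := by gcongr
        _ = (√(p : ℝ) * √p) * (165 * √((p : ℝ) ^ k) * √((m.gcd n).gcd (p ^ k) : ℝ)) := by
            rw [hss]
        _ = _ := by ring
    · have hgpos : (1 : ℝ) ≤ √(((m.gcd n).gcd (p ^ (k + 1)) : ℕ) : ℝ) := by
        rw [Real.one_le_sqrt]
        exact_mod_cast Nat.gcd_pos_of_pos_right _ (pow_pos hp.pos _)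
      refine le_trans ?_ (le_mul_of_one_le_right (by positivity) hgpos)
      rcases Nat.eq_zero_or_pos k with rfl | hk
      · have h1 := aux (p ^ (0 + 1)) (by simp) ψ hψ m n hmn
        have := Real.sqrt_nonneg ((p ^ (0 + 1) : ℕ) : ℝ)
        linarith
      · exact norm_unitSum_prime_pow_le hp (by omega) hψ hmn

end Reduction

section CRT

/-- The isomorphism of unit groups of the Chinese remainder theorem. -/
noncomputable def unitsCRT {a b : ℕ} (hab : a.Coprime b) :
    (ZMod (a * b))ˣ ≃* (ZMod a)ˣ × (ZMod b)ˣ :=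
  (Units.mapEquiv (ZMod.chineseRemainder hab).toMulEquiv).trans MulEquiv.prodUnits

lemma unitsCRT_fst {a b : ℕ} (hab : a.Coprime b) (t : (ZMod (a * b))ˣ) :
    (((unitsCRT hab t).1 : (ZMod a)ˣ) : ZMod a) = (ZMod.chineseRemainder hab t).1 := rfl

lemma unitsCRT_snd {a b : ℕ} (hab : a.Coprime b) (t : (ZMod (a * b))ˣ) :
    (((unitsCRT hab t).2 : (ZMod b)ˣ) : ZMod b) = (ZMod.chineseRemainder hab t).2 := rfl

lemma exists_primitive_factors {a b : ℕ} [NeZero a] [NeZero b] (hab : a.Coprime b)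
    {ψ : AddChar (ZMod (a * b)) ℂ} (hψ : ψ.IsPrimitive) :
    ∃ (ψ₁ : AddChar (ZMod a) ℂ) (ψ₂ : AddChar (ZMod b) ℂ), ψ₁.IsPrimitive ∧ ψ₂.IsPrimitive ∧
      ∀ m n : ℤ, unitSum ψ (m : ZMod (a * b)) n =
        unitSum ψ₁ (m : ZMod a) n * unitSum ψ₂ (m : ZMod b) n := by
  set e := ZMod.chineseRemainder hab with he
  set ψ₁ : AddChar (ZMod a) ℂ := ψ.compAddMonoidHom
    (e.symm.toAddEquiv.toAddMonoidHom.comp (AddMonoidHom.inl (ZMod a) (ZMod b))) with h₁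
  set ψ₂ : AddChar (ZMod b) ℂ := ψ.compAddMonoidHom
    (e.symm.toAddEquiv.toAddMonoidHom.comp (AddMonoidHom.inr (ZMod a) (ZMod b))) with h₂
  have hψ₁ : ∀ x, ψ₁ x = ψ (e.symm (x, 0)) := fun _ => rfl
  have hψ₂ : ∀ x, ψ₂ x = ψ (e.symm (0, x)) := fun _ => rfl
  refine ⟨ψ₁, ψ₂, ?_, ?_, ?_⟩
  · intro x hx h
    have hne : e.symm (x, 0) ≠ 0 := by
      rw [Ne, EmbeddingLike.map_eq_zero_iff, Prod.mk_eq_zero]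
      exact fun h => hx h.1
    apply hψ hne
    ext y
    have := DFunLike.congr_fun h (e y).1
    rw [AddChar.mulShift_apply, hψ₁, AddChar.one_apply] at this
    rw [AddChar.mulShift_apply, AddChar.one_apply, ← this]
    congr 1
    apply e.injective
    rw [map_mul, e.apply_symm_apply, e.apply_symm_apply]
    ext <;> simp
  · intro x hx h
    have hne : e.symm (0, x) ≠ 0 := by
      rw [Ne, EmbeddingLike.map_eq_zero_iff, Prod.mk_eq_zero]
      exact fun h => hx h.2
    apply hψ hne
    ext y
    have := DFunLike.congr_fun h (e y).2
    rw [AddChar.mulShift_apply, hψ₂, AddChar.one_apply] at this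
    rw [AddChar.mulShift_apply, AddChar.one_apply, ← this]
    congr 1
    apply e.injective
    rw [map_mul, e.apply_symm_apply, e.apply_symm_apply]
    ext <;> simp
  · intro m n
    have hsplit : ∀ x, ψ x = ψ₁ (e x).1 * ψ₂ (e x).2 := by
      intro x
      rw [hψ₁, hψ₂, ← AddChar.map_add_eq_mul, ← map_add]
      congr 1
      apply e.injective
      rw [e.apply_symm_apply]
      ext <;> simp
    rw [unitSum, unitSum, unitSum, sum_mul_sum, ← sum_product', univ_product_univ]
    refine Fintype.sum_equiv (unitsCRT hab).toEquiv _ _ fun t => ?_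
    rw [hsplit]
    have e1 : ((((unitsCRT hab t).1)⁻¹ : (ZMod a)ˣ) : ZMod a) =
        (e ((t⁻¹ : (ZMod (a * b))ˣ) : ZMod (a * b))).1 := by
      rw [← Prod.fst_inv, ← map_inv]; rfl
    have e2 : ((((unitsCRT hab t).2)⁻¹ : (ZMod b)ˣ) : ZMod b) =
        (e ((t⁻¹ : (ZMod (a * b))ˣ) : ZMod (a * b))).2 := by
      rw [← Prod.snd_inv, ← map_inv]; rfl
    change _ = ψ₁ (m * ((unitsCRT hab t).1 : ZMod a) ^ 3 + n * (((unitsCRT hab t).1)⁻¹ : (ZMod a)ˣ) ^ 2)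
      * ψ₂ (m * ((unitsCRT hab t).2 : ZMod b) ^ 3 + n * (((unitsCRT hab t).2)⁻¹ : (ZMod b)ˣ) ^ 2)
    rw [e1, e2, unitsCRT_fst, unitsCRT_snd]
    simp only [map_add, map_mul, map_pow, map_intCast, Prod.fst_add, Prod.fst_mul, Prod.pow_fst,
      Prod.snd_add, Prod.snd_mul, Prod.pow_snd, Prod.fst_intCast, Prod.snd_intCast, he]

lemma two_pow_le_card_divisors_pow {p : ℕ} (hp : p.Prime) {k : ℕ} (hk : 0 < k) :
    256 ≤ #(p ^ k).divisors ^ 8 := by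
  rw [Nat.divisors_prime_pow hp, card_map, card_range]
  calc 256 = 2 ^ 8 := by norm_num
    _ ≤ _ := Nat.pow_le_pow_left (by omega) 8

/-- The bound for complete sums to an arbitrary modulus. -/
theorem norm_unitSum_le (q : ℕ) [NeZero q] {ψ : AddChar (ZMod q) ℂ} (hψ : ψ.IsPrimitive)
    (m n : ℤ) : ‖unitSum ψ (m : ZMod q) n‖ ≤
      (#q.divisors : ℝ) ^ 8 * √(q : ℝ) * √(((m.gcd n).gcd q : ℕ) : ℝ) := by
  suffices main : ∀ q : ℕ, ∀ [NeZero q], ∀ ψ : AddChar (ZMod q) ℂ, ψ.IsPrimitive →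
      ‖unitSum ψ (m : ZMod q) n‖ ≤
        (#q.divisors : ℝ) ^ 8 * √(q : ℝ) * √(((m.gcd n).gcd q : ℕ) : ℝ) from main q ψ hψ
  clear hψ ψ
  intro q
  induction q using Nat.recOnPosPrimePosCoprime with
  | zero =>
    intro h
    exact absurd rfl h.out
  | one =>
    intro _ ψ _
    refine (norm_unitSum_le_card _ _ _).trans ?_
    rw [ZMod.card]
    simp
  | prime_pow p k hp hk =>
    intro _ ψ hψ
    refine (norm_unitSum_pow_le hp k hψ m n).trans ?_
    have : (256 : ℝ) ≤ (#(p ^ k).divisors : ℝ) ^ 8 := by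
      exact_mod_cast two_pow_le_card_divisors_pow hp hk
    gcongr
    linarith
  | coprime a b ha hb hab iha ihb =>
    intro _ ψ hψ
    have : NeZero a := ⟨by omega⟩
    have : NeZero b := ⟨by omega⟩
    obtain ⟨ψ₁, ψ₂, h₁, h₂, h⟩ := exists_primitive_factors hab hψ
    rw [h, norm_mul, Nat.Coprime.card_divisors_mul hab, Nat.Coprime.gcd_mul _ hab]
    push_cast
    rw [Real.sqrt_mul (by positivity), Real.sqrt_mul (by positivity)]
    refine (mul_le_mul (iha ψ₁ h₁) (ihb ψ₂ h₂) (norm_nonneg _) (by positivity)).trans_eq ?_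
    ring

theorem card_pow_eq_one_le (q : ℕ) [NeZero q] {j : ℕ} (hj : j = 2 ∨ j = 3 ∨ j = 5) :
    #{t : (ZMod q)ˣ | t ^ j = 1} ≤ #q.divisors ^ 8 := by
  suffices main : ∀ q : ℕ, ∀ [NeZero q], #{t : (ZMod q)ˣ | t ^ j = 1} ≤ #q.divisors ^ 8 from
    main q
  intro q
  induction q using Nat.recOnPosPrimePosCoprime with
  | zero =>
    intro h
    exact absurd rfl h.out
  | one =>
    intro _
    exact (card_le_univ _).trans (by simp)
  | prime_pow p k hp hk =>
    intro _
    have := two_pow_le_card_divisors_pow hp hk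
    exact (card_pow_eq_one_prime_pow hp k hj).trans (by omega)
  | coprime a b ha hb hab iha ihb =>
    intro _
    have : NeZero a := ⟨by omega⟩
    have : NeZero b := ⟨by omega⟩
    rw [Nat.Coprime.card_divisors_mul hab, mul_pow]
    refine le_trans ?_ (Nat.mul_le_mul iha ihb)
    rw [← card_product]
    refine card_le_card_of_injOn (unitsCRT hab) ?_ (unitsCRT hab).injective.injOn
    intro t ht
    simp only [coe_filter, mem_univ, true_and, Set.mem_ofPred_eq, coe_product, Set.mem_prod] at ht ⊢
    rw [← Prod.pow_fst, ← Prod.pow_snd, ← map_pow, ht, map_one]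
    exact ⟨rfl, rfl⟩

end CRT

section Completion

variable {q : ℕ} [NeZero q]

lemma fejer_lower_bound {A x : ℕ} (hx : x < A) :
    ((q / (6 * A) + 1 : ℕ) : ℝ) ^ 2 / 4 ≤
      ‖∑ h ∈ range (q / (6 * A) + 1), ZMod.stdAddChar ((h : ZMod q) * (x : ZMod q))‖ ^ 2 := by
  have hq : (0 : ℝ) < q := by exact_mod_cast NeZero.pos q
  have h1 : ((q / (6 * A) + 1 : ℕ) : ℝ) / 2 ≤
      (∑ h ∈ range (q / (6 * A) + 1), ZMod.stdAddChar ((h : ZMod q) * (x : ZMod q))).re := by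
    rw [Complex.re_sum]
    have : ((q / (6 * A) + 1 : ℕ) : ℝ) / 2 = ∑ h ∈ range (q / (6 * A) + 1), (1 / 2 : ℝ) := by
      rw [sum_const, card_range, nsmul_eq_mul]
      ring
    rw [this]
    refine sum_le_sum fun h hh => ?_
    rw [mem_range, Nat.lt_succ_iff] at hh
    have hhx : 6 * (h * x) ≤ q := by
      calc 6 * (h * x) ≤ 6 * (q / (6 * A) * A) := by gcongr
        _ = q / (6 * A) * (6 * A) := by ring
        _ ≤ q := Nat.div_mul_le_self _ _
    have hhx' : 6 * ((h : ℝ) * x) ≤ q := by exact_mod_cast hhx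
    have hcast : (h : ZMod q) * (x : ZMod q) = (((h * x : ℕ) : ℤ) : ZMod q) := by push_cast; rfl
    rw [hcast, ZMod.stdAddChar_coe]
    have he : 2 * (Real.pi : ℂ) * Complex.I * (((h * x : ℕ) : ℤ) : ℂ) / (q : ℂ) =
        ((2 * Real.pi * (h * x) / q : ℝ) : ℂ) * Complex.I := by
      push_cast
      ring
    rw [he, Complex.exp_ofReal_mul_I_re, ← Real.cos_pi_div_three]
    apply Real.cos_le_cos_of_nonneg_of_le_pi
    · positivity
    · linarith [Real.pi_pos]
    · rw [div_le_iff₀ hq]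
      nlinarith [Real.pi_pos]
  have h2 := h1.trans (Complex.re_le_norm _)
  have h3 : (0 : ℝ) ≤ ((q / (6 * A) + 1 : ℕ) : ℝ) / 2 := by positivity
  nlinarith

lemma norm_sum_sq_eq (ψ : AddChar (ZMod q) ℂ) (H : ℕ) (z : ZMod q) :
    ((‖∑ h ∈ range H, ψ ((h : ZMod q) * z)‖ ^ 2 : ℝ) : ℂ) =
      ∑ r ∈ range H ×ˢ range H, ψ ((((r.1 : ℤ) - r.2 : ℤ) : ZMod q) * z) := by
  rw [Complex.ofReal_pow, ← Complex.mul_conj', map_sum, sum_mul_sum, ← sum_product']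
  refine sum_congr rfl fun r _ => ?_
  rw [← AddChar.map_neg_eq_conj, ← AddChar.map_add_eq_mul]
  congr 1
  push_cast
  ring

lemma card_dvd_sub_le (H d : ℕ) :
    #{r ∈ range H ×ˢ range H | (d : ℤ) ∣ (r.1 : ℤ) - r.2} ≤ H * (H / d + 1) := by
  have hcard : H * (H / d + 1) = #(range H ×ˢ range (H / d + 1)) := by
    rw [card_product, card_range, card_range]
  rw [hcard]
  refine card_le_card_of_injOn (fun r => (r.2, r.1 / d)) ?_ ?_
  · intro r hr
    simp only [coe_filter, mem_product, mem_range, Set.mem_ofPred_eq, coe_product, coe_range,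
      Set.mem_prod, Set.mem_Iio] at hr ⊢
    exact ⟨hr.1.2, Nat.lt_succ_of_le (Nat.div_le_div_right hr.1.1.le)⟩
  · rintro ⟨r1, r2⟩ hr ⟨s1, s2⟩ hs h
    simp only [coe_filter, mem_product, mem_range, Set.mem_ofPred_eq, Prod.mk.injEq] at hr hs h ⊢
    obtain ⟨rfl, h2⟩ := h
    refine ⟨?_, rfl⟩
    have h3 : (d : ℤ) ∣ (s1 : ℤ) - r1 := by
      have := dvd_sub hs.2 hr.2
      simpa using this
    have h4 : r1 ≡ s1 [MOD d] := (Nat.modEq_iff_dvd).2 h3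
    rw [← Nat.div_add_mod r1 d, ← Nat.div_add_mod s1 d, h2, h4]

lemma sum_sqrt_gcd_le (H K : ℕ) (L M : ℤ) (hL : IsCoprime (q : ℤ) L) (hM : IsCoprime (q : ℤ) M) :
    ∑ r ∈ range H ×ˢ range H, ∑ s ∈ range K ×ˢ range K,
      √((((L * ((r.1 : ℤ) - r.2)).gcd (M * ((s.1 : ℤ) - s.2))).gcd q : ℕ) : ℝ) ≤
    #q.divisors * (H * K * (3 * (H * K) + √(q : ℝ))) := by
  have hq := NeZero.pos q
  have h1 : ∀ r s : ℕ × ℕ, √((((L * ((r.1 : ℤ) - r.2)).gcd (M * ((s.1 : ℤ) - s.2))).gcd q : ℕ) : ℝ)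
      ≤ ∑ d ∈ q.divisors, √(d : ℝ) * ((if (d : ℤ) ∣ (r.1 : ℤ) - r.2 then 1 else 0) *
        (if (d : ℤ) ∣ (s.1 : ℤ) - s.2 then 1 else 0)) := by
    intro r s
    set g := ((L * ((r.1 : ℤ) - r.2)).gcd (M * ((s.1 : ℤ) - s.2))).gcd q with hg
    have hgq : g ∣ q := Nat.gcd_dvd_right _ _
    have hgq' : (g : ℤ) ∣ q := by exact_mod_cast hgq
    have hg1 : (g : ℤ) ∣ (r.1 : ℤ) - r.2 := by
      refine (hL.of_isCoprime_of_dvd_left hgq').dvd_of_dvd_mul_left ?_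
      exact (Int.natCast_dvd_natCast.2 (Nat.gcd_dvd_left _ _)).trans (Int.gcd_dvd_left ..)
    have hg2 : (g : ℤ) ∣ (s.1 : ℤ) - s.2 := by
      refine (hM.of_isCoprime_of_dvd_left hgq').dvd_of_dvd_mul_left ?_
      exact (Int.natCast_dvd_natCast.2 (Nat.gcd_dvd_left _ _)).trans (Int.gcd_dvd_right ..)
    refine le_trans ?_ (single_le_sum (fun d _ => by positivity)
      (Nat.mem_divisors.2 ⟨hgq, hq.ne'⟩))
    rw [if_pos hg1, if_pos hg2]
    simp
  calc _ ≤ ∑ r ∈ range H ×ˢ range H, ∑ s ∈ range K ×ˢ range K,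
        ∑ d ∈ q.divisors, √(d : ℝ) * ((if (d : ℤ) ∣ (r.1 : ℤ) - r.2 then 1 else 0) *
        (if (d : ℤ) ∣ (s.1 : ℤ) - s.2 then 1 else 0)) :=
        sum_le_sum fun r _ => sum_le_sum fun s _ => h1 r s
    _ = ∑ d ∈ q.divisors, √(d : ℝ) * ((#{r ∈ range H ×ˢ range H | (d : ℤ) ∣ (r.1 : ℤ) - r.2} : ℝ) *
        #{r ∈ range K ×ˢ range K | (d : ℤ) ∣ (r.1 : ℤ) - r.2}) := by
        simp_rw [sum_comm (t := q.divisors)]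
        refine sum_congr rfl fun d _ => ?_
        rw [← sum_boole, ← sum_boole, sum_mul_sum, mul_sum]
        exact sum_congr rfl fun r _ => by rw [mul_sum]
    _ ≤ ∑ d ∈ q.divisors, (H * K * (3 * (H * K) + √(q : ℝ))) := by
        refine sum_le_sum fun d hd => ?_
        have hd0 : 0 < d := Nat.pos_of_mem_divisors hd
        have hdq : d ≤ q := Nat.divisor_le hd
        have c : ∀ H : ℕ, (#{r ∈ range H ×ˢ range H | (d : ℤ) ∣ (r.1 : ℤ) - r.2} : ℝ) ≤
            H * (H / d + 1) := by
          intro H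
          calc (#{r ∈ range H ×ˢ range H | (d : ℤ) ∣ (r.1 : ℤ) - r.2} : ℝ)
              ≤ H * ((H / d : ℕ) + 1) := by exact_mod_cast card_dvd_sub_le H d
            _ ≤ H * (H / d + 1) := by gcongr; exact Nat.cast_div_le
        have hs1 : 1 ≤ √(d : ℝ) := Real.one_le_sqrt.2 (by exact_mod_cast hd0)
        have hss : √(d : ℝ) * √d = d := Real.mul_self_sqrt (by positivity)
        have hsq : √(d : ℝ) ≤ √q := Real.sqrt_le_sqrt (by exact_mod_cast hdq)
        rcases Nat.eq_zero_or_pos H with rfl | hH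
        · simp
        rcases Nat.eq_zero_or_pos K with rfl | hK
        · simp
        have hHR : (1 : ℝ) ≤ H := by exact_mod_cast hH
        have hKR : (1 : ℝ) ≤ K := by exact_mod_cast hK
        have e1 : √(d : ℝ) / d ≤ 1 := by
          rw [div_le_one (by exact_mod_cast hd0)]
          nlinarith
        have e2 : √(d : ℝ) * ((H / d + 1) * (K / d + 1)) ≤ 3 * (H * K) + √(q : ℝ) := by
          have e3 : √(d : ℝ) * ((H / d + 1) * (K / d + 1)) =
              √(d : ℝ) / d * (H * K / d + H + K) + √d := by
            field_simp
            ring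
          have e4 : (H * K / d + H + K : ℝ) ≤ 3 * (H * K) := by
            have : (H * K / d : ℝ) ≤ H * K := div_le_self (by positivity) (by exact_mod_cast hd0)
            nlinarith
          have e5 : √(d : ℝ) / d * (H * K / d + H + K) ≤ 1 * (3 * (H * K)) := by gcongr
          linarith
        calc √(d : ℝ) * ((#{r ∈ range H ×ˢ range H | (d : ℤ) ∣ (r.1 : ℤ) - r.2} : ℝ) *
              #{r ∈ range K ×ˢ range K | (d : ℤ) ∣ (r.1 : ℤ) - r.2})
            ≤ √(d : ℝ) * ((H * (H / d + 1)) * (K * (K / d + 1))) := by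
              gcongr
              · exact c H
              · exact c K
          _ = H * K * (√(d : ℝ) * ((H / d + 1) * (K / d + 1))) := by ring
          _ ≤ _ := by gcongr
    _ = _ := by rw [sum_const, nsmul_eq_mul]

/-- The number of solutions of `a² b³ = l` in a box, by completion. -/
lemma card_box_le_of_le (l : (ZMod q)ˣ) {A B : ℕ} (hA : 0 < A) (hB : 0 < B) (hAq : A ≤ q)
    (hBq : B ≤ q) :
    (#{r ∈ Ico A (2 * A) ×ˢ Ico B (2 * B) | (r.1 : ZMod q) ^ 2 * (r.2 : ZMod q) ^ 3 = l} : ℝ) ≤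
      576 * (#q.divisors : ℝ) ^ 9 * (√q + A * B / q) := by
  classical
  set S := {r ∈ Ico A (2 * A) ×ˢ Ico B (2 * B) | (r.1 : ZMod q) ^ 2 * (r.2 : ZMod q) ^ 3 = l}
    with hS
  set H := q / (6 * A) + 1 with hH
  set K := q / (6 * B) + 1 with hK
  let ψ : AddChar (ZMod q) ℂ := ZMod.stdAddChar
  have hψ : ψ.IsPrimitive := ZMod.isPrimitive_stdAddChar q
  set u : (ZMod q)ˣ → ZMod q := fun t => ((l⁻¹ : (ZMod q)ˣ) : ZMod q) * t ^ 3 with hu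
  set v : (ZMod q)ˣ → ZMod q := fun t => (l : ZMod q) * ((t⁻¹ : (ZMod q)ˣ) : ZMod q) ^ 2 with hv
  set W : (ZMod q)ˣ → ℝ := fun t => ‖∑ h ∈ range H, ψ ((h : ZMod q) * (u t - A))‖ ^ 2 *
    ‖∑ h ∈ range K, ψ ((h : ZMod q) * (v t - B))‖ ^ 2 with hW
  have hunit : ∀ r ∈ S, ∃ t : (ZMod q)ˣ, u t = r.1 ∧ v t = r.2 := by
    intro r hr
    have h := (mem_filter.1 hr).2
    have h1 : IsUnit ((r.1 : ZMod q) * r.2) := by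
      have : IsUnit ((r.1 : ZMod q) * r.2 * ((r.1 : ZMod q) * r.2 ^ 2)) := by
        convert l.isUnit using 1
        rw [← h]; ring
      exact isUnit_of_mul_isUnit_left this
    obtain ⟨t, ht⟩ := h1
    refine ⟨t, ?_, ?_⟩
    · simp only [hu]
      rw [ht]
      have : ((l⁻¹ : (ZMod q)ˣ) : ZMod q) * l = 1 := l.inv_mul
      linear_combination (r.1 : ZMod q) * this + (r.1 : ZMod q) * ((l⁻¹ : (ZMod q)ˣ) : ZMod q) * h
    · simp only [hv]
      rw [← h]
      have : (t : ZMod q) * ((t⁻¹ : (ZMod q)ˣ) : ZMod q) = 1 := t.mul_inv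
      have h2 : (r.1 : ZMod q) ^ 2 * r.2 ^ 3 = r.2 * t ^ 2 := by rw [ht]; ring
      rw [h2]
      linear_combination (r.2 : ZMod q) * (t * ((t⁻¹ : (ZMod q)ˣ) : ZMod q) + 1) * this
  choose! τ hτ1 hτ2 using hunit
  have hinj : Set.InjOn τ S := by
    intro r hr s hs h
    have e1 : (r.1 : ZMod q) = s.1 := by rw [← hτ1 r hr, ← hτ1 s hs, h]
    have e2 : (r.2 : ZMod q) = s.2 := by rw [← hτ2 r hr, ← hτ2 s hs, h]
    have hr' := (mem_product.1 (mem_filter.1 hr).1)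
    have hs' := (mem_product.1 (mem_filter.1 hs).1)
    rw [mem_Ico, mem_Ico] at hr' hs'
    have key : ∀ {A a b : ℕ}, A ≤ q → A ≤ a → a < 2 * A → A ≤ b → b < 2 * A →
        (a : ZMod q) = b → a = b := by
      intro A a b hA h1 h2 h3 h4 h
      rw [ZMod.natCast_eq_natCast_iff] at h
      refine Nat.ModEq.eq_of_abs_lt h ?_
      rw [abs_lt]
      omega
    exact Prod.ext (key hAq hr'.1.1 hr'.1.2 hs'.1.1 hs'.1.2 e1)
      (key hBq hr'.2.1 hr'.2.2 hs'.2.1 hs'.2.2 e2)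
  have hlow : (#S : ℝ) * ((H : ℝ) ^ 2 / 4 * ((K : ℝ) ^ 2 / 4)) ≤ ∑ t, W t := by
    calc (#S : ℝ) * ((H : ℝ) ^ 2 / 4 * ((K : ℝ) ^ 2 / 4))
        = ∑ r ∈ S, ((H : ℝ) ^ 2 / 4 * ((K : ℝ) ^ 2 / 4)) := by rw [sum_const, nsmul_eq_mul]
      _ ≤ ∑ r ∈ S, W (τ r) := by
          refine sum_le_sum fun r hr => ?_
          have hr' := (mem_product.1 (mem_filter.1 hr).1)
          rw [mem_Ico, mem_Ico] at hr'
          simp only [hW]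
          rw [hτ1 r hr, hτ2 r hr, ← Nat.cast_sub hr'.1.1, ← Nat.cast_sub hr'.2.1]
          gcongr
          · exact fejer_lower_bound (by omega)
          · exact fejer_lower_bound (by omega)
      _ = ∑ t ∈ S.image τ, W t := (sum_image hinj).symm
      _ ≤ ∑ t, W t := sum_le_sum_of_subset_of_nonneg (subset_univ _) fun t _ _ => by
          simp only [hW]; positivity
  obtain ⟨L, hL⟩ := ZMod.intCast_surjective ((l⁻¹ : (ZMod q)ˣ) : ZMod q)
  obtain ⟨M, hM⟩ := ZMod.intCast_surjective (l : ZMod q)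
  have hLc : IsCoprime (q : ℤ) L := by
    rw [← ZMod.coe_int_isUnit_iff_isCoprime, hL]; exact Units.isUnit _
  have hMc : IsCoprime (q : ℤ) M := by
    rw [← ZMod.coe_int_isUnit_iff_isCoprime, hM]; exact Units.isUnit _
  have hexp : ((∑ t, W t : ℝ) : ℂ) = ∑ r ∈ range H ×ˢ range H, ∑ s ∈ range K ×ˢ range K,
      ψ (-((((r.1 : ℤ) - r.2 : ℤ) : ZMod q) * A) - (((s.1 : ℤ) - s.2 : ℤ) : ZMod q) * B) *
        unitSum ψ ((L * ((r.1 : ℤ) - r.2) : ℤ) : ZMod q) ((M * ((s.1 : ℤ) - s.2) : ℤ) : ZMod q) := by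
    rw [Complex.ofReal_sum]
    simp_rw [hW, Complex.ofReal_mul, norm_sum_sq_eq, sum_mul_sum, unitSum, mul_sum]
    rw [sum_comm]
    refine sum_congr rfl fun r _ => ?_
    rw [sum_comm]
    refine sum_congr rfl fun s _ => sum_congr rfl fun t _ => ?_
    rw [← AddChar.map_add_eq_mul, ← AddChar.map_add_eq_mul]
    congr 1
    rw [Int.cast_mul, Int.cast_mul, hL, hM]
    simp only [hu, hv]
    ring
  have hup : ∑ t, W t ≤ (#q.divisors : ℝ) ^ 8 * √(q : ℝ) *
      (#q.divisors * (H * K * (3 * (H * K) + √(q : ℝ)))) := by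
    have h0 : 0 ≤ ∑ t, W t := sum_nonneg fun t _ => by simp only [hW]; positivity
    rw [← Real.norm_of_nonneg h0, ← Complex.norm_real, hexp]
    refine le_trans ?_ (mul_le_mul_of_nonneg_left (sum_sqrt_gcd_le H K L M hLc hMc)
      (by positivity))
    rw [mul_sum]
    refine (norm_sum_le _ _).trans (sum_le_sum fun r _ => ?_)
    rw [mul_sum]
    refine (norm_sum_le _ _).trans (sum_le_sum fun s _ => ?_)
    rw [norm_mul, AddChar.norm_apply, one_mul]
    exact norm_unitSum_le q hψ _ _
  have hq : (0 : ℝ) < q := by exact_mod_cast NeZero.pos q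
  have hAR : (0 : ℝ) < A := by exact_mod_cast hA
  have hBR : (0 : ℝ) < B := by exact_mod_cast hB
  have hdivlow : ∀ A : ℕ, 0 < A → (q : ℝ) ≤ 6 * A * ((q / (6 * A) + 1 : ℕ) : ℝ) := by
    intro A hA
    have := Nat.lt_div_mul_add (a := q) (b := 6 * A) (by omega)
    have h2 : q ≤ 6 * A * (q / (6 * A) + 1) := by nlinarith
    exact_mod_cast h2
  have hHK : (q : ℝ) * q ≤ 36 * (A * B) * (H * K) := by
    calc (q : ℝ) * q ≤ (6 * A * H) * (6 * B * K) := by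
          gcongr
          · exact hdivlow A hA
          · exact hdivlow B hB
      _ = _ := by ring
  have hHp : (0 : ℝ) < H := by rw [hH]; positivity
  have hKp : (0 : ℝ) < K := by rw [hK]; positivity
  have hfin : (#S : ℝ) * ((H * K) * (H * K)) ≤
      (16 * (#q.divisors : ℝ) ^ 9 * (3 * √q * (H * K) + q)) * (H * K) := by
    have hss : √(q : ℝ) * √q = q := Real.mul_self_sqrt hq.le
    have := hlow.trans hup
    calc (#S : ℝ) * ((H * K) * (H * K)) = 16 * ((#S : ℝ) * ((H : ℝ) ^ 2 / 4 * ((K : ℝ) ^ 2 / 4))) := by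
          ring
      _ ≤ 16 * ((#q.divisors : ℝ) ^ 8 * √(q : ℝ) *
          (#q.divisors * (H * K * (3 * (H * K) + √(q : ℝ))))) := by gcongr
      _ = 16 * (#q.divisors : ℝ) ^ 9 * (3 * √q * (H * K) + √(q : ℝ) * √q) * (H * K) := by ring
      _ = _ := by rw [hss]
  rw [← mul_assoc] at hfin
  have hfin2 := le_of_mul_le_mul_right hfin (by positivity)
  have hqd : (q : ℝ) ≤ 36 * (A * B / q) * (H * K) := by
    have : 36 * (A * B / q) * (H * K) = 36 * (A * B) * (H * K) / (q : ℝ) := by ring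
    rw [this, le_div_iff₀ hq]
    exact hHK
  have hfin3 : (#S : ℝ) * (H * K) ≤
      (576 * (#q.divisors : ℝ) ^ 9 * (√q + A * B / q)) * (H * K) := by
    refine hfin2.trans ?_
    have hD : (0 : ℝ) ≤ (#q.divisors : ℝ) ^ 9 := by positivity
    have hsq : 0 ≤ √(q : ℝ) * (H * K) := by positivity
    calc 16 * (#q.divisors : ℝ) ^ 9 * (3 * √q * (H * K) + q)
        ≤ 16 * (#q.divisors : ℝ) ^ 9 * (36 * (√q * (H * K)) + 36 * (A * B / q) * (H * K)) := by
          refine mul_le_mul_of_nonneg_left ?_ (by positivity)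
          nlinarith
      _ = _ := by ring
  exact le_of_mul_le_mul_right hfin3 (by positivity)

end Completion

section Box

variable {q : ℕ} [NeZero q]

lemma card_Ico_pow_eq_le {j : ℕ} (hj : j = 2 ∨ j = 3 ∨ j = 5) (A : ℕ) (c : ZMod q) :
    #{a ∈ Ico A (2 * A) | IsUnit ((a : ℕ) : ZMod q) ∧ ((a : ℕ) : ZMod q) ^ j = c} ≤
      #q.divisors ^ 8 * (A / q + 1) := by
  classical
  have h1 : #{w : (ZMod q)ˣ | (w : ZMod q) ^ j = c} ≤ #q.divisors ^ 8 := by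
    calc #{w : (ZMod q)ˣ | (w : ZMod q) ^ j = c}
        ≤ #{w : (ZMod q)ˣ | w ^ j = 1} * #{x : ZMod q | x = c} :=
          card_filter_units_pow_le j (fun x => x = c)
      _ ≤ #q.divisors ^ 8 * 1 := by
          refine Nat.mul_le_mul (card_pow_eq_one_le q hj) ?_
          rw [filter_eq' univ c, if_pos (mem_univ c), card_singleton]
      _ = _ := mul_one _
  refine le_trans ?_ (Nat.mul_le_mul_right _ h1)
  have hcard : #{w : (ZMod q)ˣ | (w : ZMod q) ^ j = c} * (A / q + 1) =
      #(({w : (ZMod q)ˣ | (w : ZMod q) ^ j = c} : Finset (ZMod q)ˣ).map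
        ⟨_, Units.val_injective⟩ ×ˢ range (A / q + 1)) := by
    rw [card_product, card_range, card_map]
  rw [hcard]
  refine card_le_card_of_injOn (fun a : ℕ => ((a : ZMod q), (a - A) / q)) ?_ ?_
  · intro a ha
    obtain ⟨ha1, hu, ha2⟩ := mem_filter.1 (mem_coe.1 ha)
    rw [mem_Ico] at ha1
    rw [mem_coe, mem_product, mem_map, mem_range]
    refine ⟨⟨hu.unit, ?_, rfl⟩, Nat.lt_succ_of_le (Nat.div_le_div_right (by omega))⟩
    simpa using ha2
  · intro a ha b hb h
    have ha1 := (mem_filter.1 (mem_coe.1 ha)).1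
    have hb1 := (mem_filter.1 (mem_coe.1 hb)).1
    rw [mem_Ico] at ha1 hb1
    rw [Prod.mk.injEq] at h
    have h4 : ((a - A : ℕ) : ZMod q) = ((b - A : ℕ) : ZMod q) := by
      rw [Nat.cast_sub ha1.1, Nat.cast_sub hb1.1, h.1]
    rw [ZMod.natCast_eq_natCast_iff] at h4
    have h5 : a - A = b - A := by
      rw [← Nat.div_add_mod (a - A) q, ← Nat.div_add_mod (b - A) q, h.2, h4]
    omega

lemma isUnit_of_sq_mul_cube_eq {R : Type*} [CommRing R] {a b : R} {l : Rˣ}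
    (h : a ^ 2 * b ^ 3 = l) : IsUnit a ∧ IsUnit b := by
  have hl : IsUnit (a ^ 2 * b ^ 3) := h ▸ l.isUnit
  rw [IsUnit.mul_iff, isUnit_pow_iff two_ne_zero, isUnit_pow_iff three_ne_zero] at hl
  exact hl

/-- The number of solutions of `a² b³ = l` in an arbitrary dyadic box. -/
theorem card_box_le (l : (ZMod q)ˣ) {A B : ℕ} (hA : 0 < A) (hB : 0 < B) :
    (#{r ∈ Ico A (2 * A) ×ˢ Ico B (2 * B) | (r.1 : ZMod q) ^ 2 * (r.2 : ZMod q) ^ 3 = l} : ℝ) ≤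
      576 * (#q.divisors : ℝ) ^ 9 * (√q + A * B / q) := by
  classical
  have hq : (0 : ℝ) < q := by exact_mod_cast NeZero.pos q
  have hD : (1 : ℝ) ≤ #q.divisors := by
    exact_mod_cast card_pos.2 (Nat.nonempty_divisors.2 (NeZero.ne q))
  have large : ∀ {N A B : ℕ}, q < A → N ≤ B * (#q.divisors ^ 8 * (A / q + 1)) →
      (N : ℝ) ≤ 576 * (#q.divisors : ℝ) ^ 9 * (√q + A * B / q) := by
    intro N A B hAq hN
    have h1 : (1 : ℝ) ≤ A / q := by
      rw [one_le_div hq]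
      exact_mod_cast hAq.le
    calc (N : ℝ) ≤ B * (#q.divisors ^ 8 * ((A / q : ℕ) + 1)) := by exact_mod_cast hN
      _ ≤ B * (#q.divisors ^ 9 * ((A : ℝ) / q + A / q)) := by
          gcongr
          · norm_num
          · exact Nat.cast_div_le
      _ = 2 * (#q.divisors : ℝ) ^ 9 * (0 + A * B / q) := by ring
      _ ≤ 576 * (#q.divisors : ℝ) ^ 9 * (√q + A * B / q) := by
          gcongr
          · norm_num
          · positivity
  rcases le_or_gt A q with hAq | hAq
  · rcases le_or_gt B q with hBq | hBq
    · exact card_box_le_of_le l hA hB hAq hBq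
    · rw [mul_comm (A : ℝ)]
      refine large hBq ?_
      rw [card_filter, sum_product]
      calc ∑ a ∈ Ico A (2 * A), ∑ b ∈ Ico B (2 * B),
            (if (a : ZMod q) ^ 2 * (b : ZMod q) ^ 3 = l then 1 else 0)
          ≤ ∑ a ∈ Ico A (2 * A), #q.divisors ^ 8 * (B / q + 1) := by
            refine sum_le_sum fun a _ => ?_
            rw [← card_filter]
            by_cases ha : IsUnit (a : ZMod q)
            · refine le_trans (card_le_card fun b hb => ?_)
                (card_Ico_pow_eq_le (q := q) (j := 3) (by omega) B
                  ((((ha.unit ^ 2)⁻¹ : (ZMod q)ˣ) : ZMod q) * (l : ZMod q)))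
              rw [mem_filter] at hb ⊢
              refine ⟨hb.1, (isUnit_of_sq_mul_cube_eq hb.2).2, ?_⟩
              rw [← hb.2, Units.eq_inv_mul_iff_mul_eq]
              simp
            · rw [card_eq_zero.2]
              · exact Nat.zero_le _
              · exact filter_eq_empty_iff.2 fun b _ h => ha (isUnit_of_sq_mul_cube_eq h).1
        _ = A * (#q.divisors ^ 8 * (B / q + 1)) := by
            rw [sum_const, Nat.card_Ico, smul_eq_mul]
            congr 1
            omega
  · refine large hAq ?_
    rw [card_filter, sum_product_right]
    calc ∑ b ∈ Ico B (2 * B), ∑ a ∈ Ico A (2 * A),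
          (if (a : ZMod q) ^ 2 * (b : ZMod q) ^ 3 = l then 1 else 0)
        ≤ ∑ b ∈ Ico B (2 * B), #q.divisors ^ 8 * (A / q + 1) := by
          refine sum_le_sum fun b _ => ?_
          rw [← card_filter]
          by_cases hb : IsUnit (b : ZMod q)
          · refine le_trans (card_le_card fun a ha => ?_)
              (card_Ico_pow_eq_le (q := q) (j := 2) (by omega) A
                ((l : ZMod q) * (((hb.unit ^ 3)⁻¹ : (ZMod q)ˣ) : ZMod q)))
            rw [mem_filter] at ha ⊢
            refine ⟨ha.1, (isUnit_of_sq_mul_cube_eq ha.2).1, ?_⟩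
            rw [← ha.2, Units.eq_mul_inv_iff_mul_eq]
            simp
          · rw [card_eq_zero.2]
            · exact Nat.zero_le _
            · exact filter_eq_empty_iff.2 fun a _ h => hb (isUnit_of_sq_mul_cube_eq h).2
      _ = B * (#q.divisors ^ 8 * (A / q + 1)) := by
          rw [sum_const, Nat.card_Ico, smul_eq_mul]
          congr 1
          omega

end Box

lemma exists_succ_le_mul_two_rpow {δ : ℝ} (hδ : 0 < δ) :
    ∃ M : ℝ, 1 ≤ M ∧ ∀ k : ℕ, (k + 1 : ℝ) ≤ M * ((2 : ℝ) ^ k) ^ δ := by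
  have hl : 0 < δ * Real.log 2 := mul_pos hδ (Real.log_pos one_lt_two)
  refine ⟨max 1 (1 / (δ * Real.log 2)), le_max_left _ _, fun k => ?_⟩
  have h1 : 1 + k * (δ * Real.log 2) ≤ ((2 : ℝ) ^ k) ^ δ := by
    rw [Real.rpow_def_of_pos (by positivity), Real.log_pow]
    linarith [Real.add_one_le_exp (k * Real.log 2 * δ)]
  have h2 : 1 ≤ max 1 (1 / (δ * Real.log 2)) * (δ * Real.log 2) := by
    rw [← div_le_iff₀ hl]
    exact le_max_right _ _
  have h3 : 1 ≤ max 1 (1 / (δ * Real.log 2)) := le_max_left _ _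
  set M := max 1 (1 / (δ * Real.log 2))
  calc (k + 1 : ℝ) ≤ k * (M * (δ * Real.log 2)) + M := by
        gcongr
        exact le_mul_of_one_le_right (by positivity) h2
    _ = M * (1 + k * (δ * Real.log 2)) := by ring
    _ ≤ _ := by gcongr

/-- The divisor bound. -/
theorem exists_card_divisors_le {δ : ℝ} (hδ : 0 < δ) :
    ∃ C : ℝ, 1 ≤ C ∧ ∀ n : ℕ, 0 < n → (#n.divisors : ℝ) ≤ C * (n : ℝ) ^ δ := by
  obtain ⟨M, hM1, hM⟩ := exists_succ_le_mul_two_rpow hδ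
  obtain ⟨P, hP⟩ := exists_nat_ge ((2 : ℝ) ^ (1 / δ))
  have key : ∀ n : ℕ, 0 < n →
      (#n.divisors : ℝ) ≤ M ^ #{p ∈ n.primeFactors | p < P} * (n : ℝ) ^ δ := by
    intro n
    induction n using Nat.recOnPosPrimePosCoprime with
    | zero => intro h; exact absurd h (lt_irrefl 0)
    | one => simp
    | prime_pow p k hp hk =>
      intro _
      rw [Nat.divisors_prime_pow hp, card_map, card_range, Nat.primeFactors_prime_pow hk.ne' hp,
        Nat.cast_pow]
      have hp2 : (2 : ℝ) ≤ p := by exact_mod_cast hp.two_le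
      push_cast
      by_cases hpP : p < P
      · rw [filter_singleton, if_pos hpP, card_singleton, pow_one]
        refine (hM k).trans ?_
        gcongr
      · rw [filter_singleton, if_neg hpP, card_empty, pow_zero, one_mul]
        have h2 : (2 : ℝ) ≤ (p : ℝ) ^ δ := by
          calc (2 : ℝ) = ((2 : ℝ) ^ (1 / δ)) ^ δ := by
                rw [← Real.rpow_mul zero_le_two, one_div_mul_cancel hδ.ne', Real.rpow_one]
            _ ≤ (p : ℝ) ^ δ := by
                gcongr
                exact hP.trans (by exact_mod_cast not_lt.1 hpP)
        calc (k + 1 : ℝ) ≤ 2 ^ k := by exact_mod_cast Nat.lt_two_pow_self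
          _ ≤ ((p : ℝ) ^ δ) ^ k := by gcongr
          _ = ((p : ℝ) ^ k) ^ δ := Real.rpow_pow_comm (by positivity) δ k
    | coprime a b ha hb hab iha ihb =>
      intro _
      rw [hab.card_divisors_mul, hab.primeFactors_mul, filter_union,
        card_union_of_disjoint (disjoint_filter_filter hab.disjoint_primeFactors), pow_add,
        Nat.cast_mul, Nat.cast_mul, Real.mul_rpow (by positivity) (by positivity)]
      calc (#a.divisors : ℝ) * #b.divisors
          ≤ (M ^ #{p ∈ a.primeFactors | p < P} * (a : ℝ) ^ δ) *
            (M ^ #{p ∈ b.primeFactors | p < P} * (b : ℝ) ^ δ) := by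
            gcongr
            · exact iha (by omega)
            · exact ihb (by omega)
        _ = _ := by ring
  refine ⟨M ^ P, one_le_pow₀ hM1, fun n hn => (key n hn).trans ?_⟩
  gcongr
  · calc #{p ∈ n.primeFactors | p < P} ≤ #(range P) :=
          card_le_card fun p hp => mem_range.2 (mem_filter.1 hp).2
      _ = P := card_range P

lemma exists_eq_sq_mul_cube {n : ℕ} (hn : 0 < n) (h : Squarefull n) :
    ∃ a b : ℕ, 0 < a ∧ 0 < b ∧ n = a ^ 2 * b ^ 3 := by
  obtain ⟨b, c, hb, hc, rfl, hsq⟩ := Nat.sq_mul_squarefree_of_pos hn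
  have hdvd : b ∣ c := by
    rw [← Nat.prod_primeFactors_of_squarefree hsq]
    refine Finset.prod_primes_dvd c (fun p hp => (Nat.prime_of_mem_primeFactors hp).prime) ?_
    intro p hp
    have hpp := Nat.prime_of_mem_primeFactors hp
    by_contra hpc
    have h1 := h p hpp (dvd_mul_of_dvd_right (Nat.dvd_of_mem_primeFactors hp) _)
    have h2 : p ^ 2 ∣ b :=
      (((Nat.Prime.coprime_iff_not_dvd hpp).2 hpc).pow 2 2).dvd_of_dvd_mul_left h1
    rw [pow_two] at h2
    exact hpp.one_lt.ne' (Nat.isUnit_iff.1 (hsq p h2))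
  obtain ⟨a, rfl⟩ := hdvd
  exact ⟨a, b, Nat.pos_of_mul_pos_left hc, hb, by ring⟩

/-- Dyadic decomposition of the squarefull numbers in a reduced residue class. -/
lemma card_squarefull_le {q x : ℕ} [NeZero q] (l : (ZMod q)ˣ) (hqx : q ^ 3 ≤ x) :
    (Nat.card {n : ℕ // 1 ≤ n ∧ n ≤ x ∧ Squarefull n ∧ (n : ZMod q) = l} : ℝ) ≤
      1152 * (Nat.log 2 x + 1 : ℝ) ^ 2 * (#q.divisors : ℝ) ^ 9 * √x / q := by
  classical
  have hq : (0 : ℝ) < q := by exact_mod_cast NeZero.pos q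
  set I := {r ∈ range (Nat.log 2 x + 1) ×ˢ range (Nat.log 2 x + 1) |
    (2 ^ r.1) ^ 2 * (2 ^ r.2) ^ 3 ≤ x} with hI
  let box : ℕ × ℕ → Finset (ℕ × ℕ) := fun i =>
    {r ∈ Ico (2 ^ i.1) (2 * 2 ^ i.1) ×ˢ Ico (2 ^ i.2) (2 * 2 ^ i.2) |
      (r.1 : ZMod q) ^ 2 * (r.2 : ZMod q) ^ 3 = l}
  have hcover : {n ∈ Icc 1 x | Squarefull n ∧ (n : ZMod q) = l} ⊆
      (I.biUnion box).image (fun r => r.1 ^ 2 * r.2 ^ 3) := by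
    intro n hn
    rw [mem_filter, mem_Icc] at hn
    obtain ⟨⟨hn1, hnx⟩, hsf, hnl⟩ := hn
    obtain ⟨a, b, ha, hb, rfl⟩ := exists_eq_sq_mul_cube hn1 hsf
    have hax : a ≤ x := by
      refine le_trans ?_ hnx
      calc a ≤ a ^ 2 := Nat.le_self_pow two_ne_zero a
        _ ≤ a ^ 2 * b ^ 3 := Nat.le_mul_of_pos_right _ (by positivity)
    have hbx : b ≤ x := by
      refine le_trans ?_ hnx
      calc b ≤ b ^ 3 := Nat.le_self_pow three_ne_zero b
        _ ≤ a ^ 2 * b ^ 3 := Nat.le_mul_of_pos_left _ (by positivity)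
    have ha2 := Nat.pow_log_le_self 2 ha.ne'
    have hb2 := Nat.pow_log_le_self 2 hb.ne'
    have ha3 := Nat.lt_pow_succ_log_self one_lt_two a
    have hb3 := Nat.lt_pow_succ_log_self one_lt_two b
    rw [pow_succ'] at ha3 hb3
    refine mem_image.2 ⟨(a, b), mem_biUnion.2 ⟨(Nat.log 2 a, Nat.log 2 b), ?_, ?_⟩, rfl⟩
    · rw [hI, mem_filter, mem_product, mem_range, mem_range]
      refine ⟨⟨Nat.lt_succ_of_le (Nat.log_mono_right (b := 2) hax),
        Nat.lt_succ_of_le (Nat.log_mono_right (b := 2) hbx)⟩, le_trans ?_ hnx⟩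
      dsimp only
      gcongr
    · simp only [box, mem_filter, mem_product, mem_Ico]
      refine ⟨⟨⟨ha2, ha3⟩, hb2, hb3⟩, ?_⟩
      rw [← hnl]
      push_cast
      rfl
  have hcard : Nat.card {n : ℕ // 1 ≤ n ∧ n ≤ x ∧ Squarefull n ∧ (n : ZMod q) = l} =
      #{n ∈ Icc 1 x | Squarefull n ∧ (n : ZMod q) = l} := by
    refine Nat.subtype_card _ fun n => ?_
    rw [mem_filter, mem_Icc, and_assoc]
  have hsqrt : √(q : ℝ) ≤ √x / q := by
    rw [le_div_iff₀ hq]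
    apply Real.le_sqrt_of_sq_le
    rw [mul_pow, Real.sq_sqrt hq.le]
    calc (q : ℝ) * (q : ℝ) ^ 2 = (q : ℝ) ^ 3 := by ring
      _ ≤ (x : ℝ) := by exact_mod_cast hqx
  have hbox : ∀ i ∈ I, (#(box i) : ℝ) ≤ 1152 * (#q.divisors : ℝ) ^ 9 * √x / q := by
    intro i hi
    have hi' := (mem_filter.1 hi).2
    have hAB : ((2 ^ i.1 : ℕ) : ℝ) * (2 ^ i.2 : ℕ) ≤ √x := by
      apply Real.le_sqrt_of_sq_le
      have : (2 ^ i.1 * 2 ^ i.2) ^ 2 ≤ x := by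
        refine le_trans ?_ hi'
        rw [mul_pow]
        exact Nat.mul_le_mul_left _ (Nat.pow_le_pow_right (by positivity) (by norm_num))
      exact_mod_cast this
    calc (#(box i) : ℝ) ≤ 576 * (#q.divisors : ℝ) ^ 9 *
          (√q + (2 ^ i.1 : ℕ) * (2 ^ i.2 : ℕ) / q) :=
          card_box_le l (by positivity) (by positivity)
      _ ≤ 576 * (#q.divisors : ℝ) ^ 9 * (√x / q + √x / q) := by gcongr
      _ = _ := by ring
  rw [hcard]
  calc (#{n ∈ Icc 1 x | Squarefull n ∧ (n : ZMod q) = l} : ℝ)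
      ≤ ∑ i ∈ I, (#(box i) : ℝ) := by
        exact_mod_cast (card_le_card hcover).trans (card_image_le.trans card_biUnion_le)
    _ ≤ ∑ i ∈ I, 1152 * (#q.divisors : ℝ) ^ 9 * √x / q := sum_le_sum hbox
    _ = #I * (1152 * (#q.divisors : ℝ) ^ 9 * √x / q) := by rw [sum_const, nsmul_eq_mul]
    _ ≤ (Nat.log 2 x + 1 : ℝ) ^ 2 * (1152 * (#q.divisors : ℝ) ^ 9 * √x / q) := by
        gcongr
        have : #I ≤ (Nat.log 2 x + 1) ^ 2 := by
          refine (card_filter_le _ _).trans_eq ?_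
          rw [card_product, card_range, sq]
        exact_mod_cast this
    _ = _ := by ring

end SquarefullAP

theorem squarefull_in_AP_bound : ∀ ε : ℝ, 0 < ε → ∃ C : ℝ, 0 < C ∧
    ∀ q l x : ℕ, 0 < q → 0 < l → 0 < x → Nat.gcd l q = 1 →
      (q : ℝ) ≤ (x : ℝ) ^ ((1 : ℝ) / 3) →
      (Nat.card {n : ℕ // 1 ≤ n ∧ n ≤ x ∧ Squarefull n ∧ n % q = l % q} : ℝ) ≤
        C * (x : ℝ) ^ ((1 : ℝ) / 2 + ε) / q := by
  intro ε hε
  obtain ⟨M, hM1, hM⟩ := SquarefullAP.exists_succ_le_mul_two_rpow (δ := ε / 4) (by positivity)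
  obtain ⟨D, hD1, hD⟩ := SquarefullAP.exists_card_divisors_le (δ := ε / 18) (by positivity)
  refine ⟨1152 * M ^ 2 * D ^ 9, by positivity, ?_⟩
  intro q l x hq _ hx hlq hqx
  have : NeZero q := ⟨hq.ne'⟩
  have hxR : (1 : ℝ) ≤ x := by exact_mod_cast hx
  have hq3 : q ^ 3 ≤ x := by
    have h : (q : ℝ) ^ 3 ≤ ((x : ℝ) ^ ((1 : ℝ) / 3)) ^ 3 := by gcongr
    rw [← Real.rpow_mul_natCast (by positivity)] at h
    norm_num at h
    exact_mod_cast h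
  have hqx' : q ≤ x := (Nat.le_self_pow three_ne_zero q).trans hq3
  have hlog : (Nat.log 2 x + 1 : ℝ) ≤ M * (x : ℝ) ^ (ε / 4) := by
    refine (hM _).trans ?_
    gcongr
    exact_mod_cast Nat.pow_log_le_self 2 hx.ne'
  have hdiv : (q.divisors.card : ℝ) ≤ D * (x : ℝ) ^ (ε / 18) := by
    refine (hD q hq).trans ?_
    gcongr
  have hpow : ((x : ℝ) ^ (ε / 4)) ^ 2 * ((x : ℝ) ^ (ε / 18)) ^ 9 * √x =
      (x : ℝ) ^ ((1 : ℝ) / 2 + ε) := by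
    rw [← Real.rpow_mul_natCast (by positivity), ← Real.rpow_mul_natCast (by positivity),
      Real.sqrt_eq_rpow, ← Real.rpow_add (by positivity), ← Real.rpow_add (by positivity)]
    congr 1
    push_cast
    ring
  have hmain := SquarefullAP.card_squarefull_le (ZMod.unitOfCoprime l hlq) hq3
  simp_rw [ZMod.coe_unitOfCoprime, ZMod.natCast_eq_natCast_iff'] at hmain
  refine hmain.trans ?_
  calc 1152 * (Nat.log 2 x + 1 : ℝ) ^ 2 * (q.divisors.card : ℝ) ^ 9 * √x / q
      ≤ 1152 * (M * (x : ℝ) ^ (ε / 4)) ^ 2 * (D * (x : ℝ) ^ (ε / 18)) ^ 9 * √x / q := by gcongr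
    _ = 1152 * M ^ 2 * D ^ 9 *
        (((x : ℝ) ^ (ε / 4)) ^ 2 * ((x : ℝ) ^ (ε / 18)) ^ 9 * √x) / q := by ring
    _ = _ := by rw [hpow]
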